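/- arXiv:1204.1136 — 4 statements merged into one kernel-verified Lean document; each statement's English description precedes it below -/
import Mathlib

section
/- Let i ∈ V, let H be the connected component of G containing i, and let n_H = |V(H)|. For any vertex j ∈ V(H), the Metropolis–Hastings walk RW(G_1) started at i visits j within the first 12·n_H² steps with probability at least 1/2; that is, Pr_i[T_j ≤ 12·n_H²] ≥ 1/2. -/
open Finset

/-- The Metropolis–Hastings transition matrix on a graph, with unit potential:
`P v u = min (1/deg v) (1/deg u)` for adjacent `u ≠ v`, `0` for non-adjacent `u ≠ v`,
and `P v v = 1 - ∑_{u ∈ Γ(v)} min (1/deg v) (1/deg u)`. -/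
noncomputable def mhMatrix {V : Type*} [Fintype V] [DecidableEq V] (G : SimpleGraph V)
    [DecidableRel G.Adj] : Matrix V V ℝ :=
  Matrix.of fun v u =>
    if u = v then
      1 - ∑ w ∈ G.neighborFinset v, min ((G.degree v : ℝ))⁻¹ ((G.degree w : ℝ))⁻¹
    else if G.Adj v u then min ((G.degree v : ℝ))⁻¹ ((G.degree u : ℝ))⁻¹
    else 0

/-- Probability, for the Markov chain with transition matrix `P` and initial distribution `μ`,
that the trajectory `(X_0, …, X_L)` lies in the event `E`. -/
noncomputable def prTraj {V : Type*} [Fintype V] (P : Matrix V V ℝ) (μ : V → ℝ) (L : ℕ)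
    (E : Set (Fin (L + 1) → V)) : ℝ :=
  ∑ x : Fin (L + 1) → V,
    E.indicator (fun y => μ (y 0) * ∏ τ : Fin L, P (y τ.castSucc) (y τ.succ)) x

/-- Point mass at `i`, as an initial distribution. -/
def dirac {V : Type*} [DecidableEq V] (i : V) : V → ℝ := fun v => if v = i then 1 else 0

set_option linter.unusedSectionVars false
section helpers

/-- Iterates of a kernel on the constant function one. -/
noncomputable def iterF {V : Type*} [Fintype V] (Q : V → V → ℝ) : ℕ → V → ℝ
  | 0 => fun _ => 1
  | (t + 1) => fun v => ∑ u, Q v u * iterF Q t u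

lemma sum_traj {V : Type*} [Fintype V] (Q : V → V → ℝ) (L : ℕ) : ∀ (w : V → ℝ),
    ∑ x : Fin (L + 1) → V, w (x 0) * ∏ τ : Fin L, Q (x τ.castSucc) (x τ.succ)
      = ∑ v, w v * iterF Q L v := by
  induction L with
  | zero =>
    intro w
    simp only [iterF, mul_one, Finset.univ_eq_empty, Finset.prod_empty]
    exact Fintype.sum_equiv (Equiv.funUnique (Fin 1) V) _ _ (fun x => rfl)
  | succ L ih =>
    intro w
    rw [← (Fin.consEquiv (fun _ : Fin (L + 2) => V)).sum_comp, Fintype.sum_prod_type]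
    refine Finset.sum_congr rfl fun a _ => ?_
    have := ih (Q a)
    simp only [iterF]
    rw [← this, Finset.mul_sum]
    refine Finset.sum_congr rfl fun y _ => ?_
    rw [Fin.prod_univ_succ]
    simp [Fin.consEquiv, ← Fin.succ_castSucc]

variable {V : Type*} [Fintype V] [DecidableEq V] (G : SimpleGraph V) [DecidableRel G.Adj]

lemma mh_symm (u v : V) : mhMatrix G u v = mhMatrix G v u := by
  simp only [mhMatrix, Matrix.of_apply]
  by_cases h : u = v
  · subst h; rfl
  · simp [h, Ne.symm h, G.adj_comm u v, min_comm]

lemma mh_row (v : V) : ∑ u, mhMatrix G v u = 1 := by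
  rw [← Finset.add_sum_erase _ _ (Finset.mem_univ v)]
  have : ∑ u ∈ Finset.univ.erase v, mhMatrix G v u
      = ∑ w ∈ G.neighborFinset v, min ((G.degree v : ℝ))⁻¹ ((G.degree w : ℝ))⁻¹ := by
    rw [← Finset.sum_subset (s₁ := G.neighborFinset v)]
    · refine Finset.sum_congr rfl fun u hu => ?_
      rw [SimpleGraph.mem_neighborFinset] at hu
      simp [mhMatrix, hu, hu.ne']
    · intro u hu
      rw [SimpleGraph.mem_neighborFinset] at hu
      simp [hu.ne']
    · intro u hu hn
      rw [SimpleGraph.mem_neighborFinset] at hn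
      simp only [Finset.mem_erase] at hu
      simp [mhMatrix, hn, hu.1]
  rw [this]
  simp [mhMatrix]

lemma mh_nonneg (u v : V) : 0 ≤ mhMatrix G u v := by
  simp only [mhMatrix, Matrix.of_apply]
  split_ifs
  · have : ∑ w ∈ G.neighborFinset u, min ((G.degree u : ℝ))⁻¹ ((G.degree w : ℝ))⁻¹
        ≤ ∑ w ∈ G.neighborFinset u, ((G.degree u : ℝ))⁻¹ :=
      Finset.sum_le_sum fun w _ => min_le_left _ _
    rw [Finset.sum_const, SimpleGraph.card_neighborFinset_eq_degree, nsmul_eq_mul] at this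
    have := mul_inv_le_one (a := (G.degree u : ℝ))
    linarith
  · positivity
  · exact le_rfl

lemma mh_adj_bound (u v : V) (h : G.Adj u v) (x : ℝ) :
    x ^ 2 ≤ ((G.degree u : ℝ) + G.degree v) * (mhMatrix G u v * x ^ 2) := by
  have hu : (0:ℝ) < G.degree u := by
    exact_mod_cast (G.degree_pos_iff_exists_adj u).2 ⟨v, h⟩
  have hv : (0:ℝ) < G.degree v := by
    exact_mod_cast (G.degree_pos_iff_exists_adj v).2 ⟨u, h.symm⟩
  have : 1 ≤ ((G.degree u : ℝ) + G.degree v) * mhMatrix G u v := by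
    simp only [mhMatrix, Matrix.of_apply, h.ne', h, if_true, if_false]
    rcases min_choice ((G.degree u : ℝ))⁻¹ ((G.degree v : ℝ))⁻¹ with e | e <;> rw [e, add_mul]
    · rw [mul_inv_cancel₀ hu.ne']; linarith [mul_pos hv (inv_pos.2 hu)]
    · rw [mul_inv_cancel₀ hv.ne']; linarith [mul_pos hu (inv_pos.2 hv)]
  nlinarith [sq_nonneg x]

lemma mh_zero {i u v : V} (hu : G.Reachable i u) (hv : ¬ G.Reachable i v) :
    mhMatrix G u v = 0 := by
  have h1 : v ≠ u := by rintro rfl; exact hv hu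
  have h2 : ¬ G.Adj u v := fun h => hv (hu.trans h.reachable)
  simp [mhMatrix, h1, h2]

/-- geodesic -/
lemma exists_geod (j : V) (d : ℕ) : ∀ v : V, G.Reachable j v → G.dist j v = d →
    ∃ q : ℕ → V, q 0 = j ∧ q d = v ∧ (∀ k ≤ d, G.dist j (q k) = k) ∧
      ∀ k < d, G.Adj (q k) (q (k + 1)) := by
  induction d with
  | zero =>
    intro v hr hd
    have := (hr.dist_eq_zero_iff).1 hd
    exact ⟨fun _ => j, rfl, this, by simp, by simp⟩
  | succ d ih =>
    intro v hr hd
    obtain ⟨p, hp⟩ := hr.symm.exists_walk_length_eq_dist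
    rw [G.dist_comm, hd] at hp
    cases p with
    | nil => simp at hp
    | @cons _ u _ h p =>
      simp only [SimpleGraph.Walk.length_cons, Nat.add_right_cancel_iff] at hp
      have h1 : G.dist j u ≤ d := by rw [G.dist_comm, ← hp]; exact SimpleGraph.dist_le p
      have h2 : G.dist j v ≤ G.dist j u + 1 := by
        obtain ⟨p', hp'⟩ := (p.reachable.symm).exists_walk_length_eq_dist
        have := SimpleGraph.dist_le (p'.concat h.symm)
        rw [SimpleGraph.Walk.length_concat] at this
        omega
      obtain ⟨q, q0, qd, qk, qa⟩ := ih u p.reachable.symm (by omega)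
      refine ⟨fun k => if k ≤ d then q k else v, by simp [q0], by simp, ?_, ?_⟩
      · intro k hk
        by_cases hkd : k ≤ d
        · simp [hkd, qk k hkd]
        · simp [hkd, hd]; omega
      · intro k hk
        by_cases hkd : k + 1 ≤ d
        · simp [hkd, (by omega : k ≤ d), qa k (by omega)]
        · obtain rfl : k = d := by omega
          simp [qd, h.symm]

lemma adj_dist_le {j u v : V} (hr : G.Reachable j u) (h : G.Adj u v) :
    G.dist j v ≤ G.dist j u + 1 := by
  obtain ⟨p', hp'⟩ := hr.exists_walk_length_eq_dist
  have := SimpleGraph.dist_le (p'.concat h)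
  rw [SimpleGraph.Walk.length_concat] at this
  omega

lemma geod_deg (j : V) (d : ℕ) (q : ℕ → V) (hr : ∀ k ≤ d, G.Reachable j (q k))
    (qk : ∀ k ≤ d, G.dist j (q k) = k) (H : Finset V) (hH : ∀ v, v ∈ H ↔ G.Reachable j v) :
    ∑ k ∈ Finset.range (d + 1), G.degree (q k) ≤ 3 * H.card := by
  have h1 : ∀ k ∈ Finset.range (d + 1), G.degree (q k) =
      ∑ w ∈ H, if G.Adj (q k) w then 1 else 0 := by
    intro k hk
    rw [Finset.mem_range] at hk
    rw [← Finset.card_filter, ← SimpleGraph.card_neighborFinset_eq_degree]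
    congr 1
    ext w
    simp only [SimpleGraph.mem_neighborFinset, Finset.mem_filter, hH]
    exact ⟨fun h => ⟨(hr k (by omega)).trans h.reachable, h⟩, fun h => h.2⟩
  rw [Finset.sum_congr rfl h1, Finset.sum_comm, mul_comm, ← smul_eq_mul]
  apply Finset.sum_le_card_nsmul
  intro w hw
  rw [hH] at hw
  rw [← Finset.card_filter]
  calc _ ≤ (Finset.Icc (G.dist j w - 1) (G.dist j w + 1)).card := by
        apply Finset.card_le_card
        intro k hk
        simp only [Finset.mem_filter, Finset.mem_range] at hk
        have hk' : k ≤ d := by omega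
        have a1 := adj_dist_le G (hr k hk') hk.2
        have a2 := adj_dist_le G hw hk.2.symm
        rw [qk k hk'] at a1 a2
        rw [Finset.mem_Icc]; omega
    _ ≤ 3 := by rw [Nat.card_Icc]; omega

/-- energy along a geodesic -/
lemma geod_energy (j : V) (d : ℕ) (q : ℕ → V) 
    (qk : ∀ k ≤ d, G.dist j (q k) = k) (e : V → V → ℝ) (he : ∀ u v, 0 ≤ e u v)
    (hs : ∀ u v, e u v = e v u) :
    2 * ∑ k ∈ Finset.range d, e (q k) (q (k + 1)) ≤ ∑ u, ∑ v, e u v := by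
  set e' : V → V → ℝ := fun u v => if G.dist j u < G.dist j v then e u v else 0 with he'
  have h1 : ∑ k ∈ Finset.range d, e (q k) (q (k + 1)) ≤ ∑ u, ∑ v, e' u v := by
    rw [← Finset.sum_product' Finset.univ Finset.univ e']
    have : ∑ k ∈ Finset.range d, e (q k) (q (k + 1))
        = ∑ z ∈ (Finset.range d).image (fun k => (q k, q (k + 1))), e' z.1 z.2 := by
      rw [Finset.sum_image]
      · refine Finset.sum_congr rfl fun k hk => ?_
        rw [Finset.mem_range] at hk
        simp [he', qk k (by omega), qk (k + 1) (by omega)]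
      · intro a ha b hb hab
        simp only [Finset.coe_range, Set.mem_Iio] at ha hb
        have := congrArg (G.dist j) (Prod.ext_iff.1 hab).1
        rwa [qk a (by omega), qk b (by omega)] at this
    rw [this]
    apply Finset.sum_le_sum_of_subset_of_nonneg
    · intro z _; simp
    · intro z _ _
      simp only [he']; split_ifs
      · exact he _ _
      · exact le_rfl
  have h2 : ∑ u, ∑ v, e' u v + ∑ u, ∑ v, e' v u ≤ ∑ u, ∑ v, e u v := by
    rw [← Finset.sum_add_distrib]
    refine Finset.sum_le_sum fun u _ => ?_
    rw [← Finset.sum_add_distrib]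
    refine Finset.sum_le_sum fun v _ => ?_
    simp only [he']
    rw [hs v u]
    have := he u v
    split_ifs <;> first | omega | linarith
  rw [Finset.sum_comm (f := fun u v => e' v u)] at h2
  linarith

lemma energy_id (P : V → V → ℝ) (hs : ∀ u v, P u v = P v u) (hrow : ∀ v, ∑ u, P v u = 1)
    (g : V → ℝ) : ∑ u, ∑ v, P u v * (g v - g u) ^ 2 = 2 * ∑ u, g u * (g u - ∑ v, P u v * g v) := by
  have h1 : ∑ u, ∑ v, P u v * g u ^ 2 = ∑ u, g u ^ 2 := by
    refine Finset.sum_congr rfl fun u _ => ?_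
    rw [← Finset.sum_mul, hrow, one_mul]
  have h2 : ∑ u, ∑ v, P u v * g v ^ 2 = ∑ u, g u ^ 2 := by
    rw [Finset.sum_comm, ← h1]
    refine Finset.sum_congr rfl fun u _ => Finset.sum_congr rfl fun v _ => ?_
    rw [hs]
  have h3 : ∑ u, g u * (g u - ∑ v, P u v * g v)
      = ∑ u, g u ^ 2 - ∑ u, ∑ v, P u v * (g u * g v) := by
    rw [← Finset.sum_sub_distrib]
    refine Finset.sum_congr rfl fun u _ => ?_
    rw [mul_sub, Finset.mul_sum, sq]
    congr 1
    refine Finset.sum_congr rfl fun v _ => ?_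
    ring
  have h4 : ∑ u, ∑ v, P u v * (g v - g u) ^ 2 = ∑ u, ∑ v, P u v * g v ^ 2
      + ∑ u, ∑ v, P u v * g u ^ 2 - 2 * ∑ u, ∑ v, P u v * (g u * g v) := by
    simp only [Finset.mul_sum, ← Finset.sum_add_distrib, ← Finset.sum_sub_distrib]
    refine Finset.sum_congr rfl fun u _ => Finset.sum_congr rfl fun v _ => ?_
    ring
  rw [h4, h3, h1, h2]; ring

/-- The key bound: a subsolution `g` on the component, vanishing at `j`, is at most `6 n²`. -/
lemma key_bound (j : V) (H : Finset V) (hH : ∀ v, v ∈ H ↔ G.Reachable j v) (g : V → ℝ)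
    (hg : ∀ v, 0 ≤ g v) (hgj : g j = 0) (hgH : ∀ v, v ∉ H → g v = 0)
    (hsub : ∀ v ∈ H, v ≠ j → g v ≤ 1 + ∑ u, mhMatrix G v u * g u) (v : V) :
    g v ≤ 6 * (H.card : ℝ) ^ 2 := by
  obtain ⟨m, -, hm⟩ := Finset.exists_max_image Finset.univ g ⟨v, Finset.mem_univ v⟩
  refine (hm v (Finset.mem_univ v)).trans ?_
  by_cases hmH : m ∈ H
  swap
  · rw [hgH m hmH]; positivity
  have hmr := (hH m).1 hmH
  obtain ⟨q, q0, qd, qk, qa⟩ := exists_geod G j _ m hmr rfl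
  set d := G.dist j m
  have hr : ∀ k ≤ d, G.Reachable j (q k) := by
    intro k
    induction k with
    | zero => intro _; rw [q0]
    | succ k ih => intro hk; exact (ih (by omega)).trans (qa k (by omega)).reachable
  have hdeg := geod_deg G j d q hr qk H hH
  have hdeg' : ∑ k ∈ Finset.range (d + 1), (G.degree (q k) : ℝ) ≤ 3 * H.card := by
    exact_mod_cast hdeg
  have hE := geod_energy G j d q qk (fun u v => mhMatrix G u v * (g v - g u) ^ 2)
    (fun u v => mul_nonneg (mh_nonneg G u v) (sq_nonneg _))
    (fun u v => by rw [mh_symm G u v]; ring)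
  rw [energy_id (mhMatrix G) (mh_symm G) (mh_row G) g] at hE
  have hE2 : ∑ u, g u * (g u - ∑ v, mhMatrix G u v * g v) ≤ H.card * g m := by
    calc _ ≤ ∑ u, g u := by
          refine Finset.sum_le_sum fun u _ => ?_
          by_cases hu : u ∈ H ∧ u ≠ j
          · have := hsub u hu.1 hu.2
            nlinarith [hg u]
          · have : g u = 0 := by
              by_cases h : u ∈ H
              · have : u = j := by tauto
                rw [this, hgj]
              · exact hgH u h
            simp [this]
      _ = ∑ u ∈ H, g u := by
          symm
          exact Finset.sum_subset (Finset.subset_univ _) fun u _ hu => hgH u hu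
      _ ≤ _ := by
          rw [← nsmul_eq_mul]
          exact Finset.sum_le_card_nsmul _ _ _ fun u _ => hm u (Finset.mem_univ u)
  have hsum : ∑ k ∈ Finset.range d, (g (q (k + 1)) - g (q k)) = g m := by
    rw [Finset.sum_range_sub (fun k => g (q k)), qd, q0, hgj, sub_zero]
  have hCS := Finset.sum_sq_le_sum_mul_sum_of_sq_le_mul (Finset.range d)
    (r := fun k => g (q (k + 1)) - g (q k))
    (f := fun k => (G.degree (q k) : ℝ) + G.degree (q (k + 1)))
    (g := fun k => mhMatrix G (q k) (q (k + 1)) * (g (q (k + 1)) - g (q k)) ^ 2)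
    (fun k _ => by positivity)
    (fun k _ => mul_nonneg (mh_nonneg G _ _) (sq_nonneg _))
    (fun k hk => mh_adj_bound G _ _ (qa k (Finset.mem_range.1 hk)) _)
  rw [hsum, Finset.sum_add_distrib] at hCS
  have hA : ∑ k ∈ Finset.range d, (G.degree (q k) : ℝ) ≤ 3 * H.card := by
    rw [Finset.sum_range_succ] at hdeg'
    have : (0:ℝ) ≤ G.degree (q d) := by positivity
    linarith
  have hB : ∑ k ∈ Finset.range d, (G.degree (q (k + 1)) : ℝ) ≤ 3 * H.card := by
    rw [Finset.sum_range_succ'] at hdeg'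
    have : (0:ℝ) ≤ G.degree (q 0) := by positivity
    linarith
  have hfin : g m ^ 2 ≤ (6 * H.card) * (H.card * g m) := by
    refine hCS.trans (mul_le_mul (by linarith) (by linarith) ?_ (by positivity))
    exact Finset.sum_nonneg fun k _ => mul_nonneg (mh_nonneg G _ _) (sq_nonneg _)
  rcases (hg m).eq_or_lt with h | h
  · rw [← h]; positivity
  · refine le_of_mul_le_mul_right ?_ h
    nlinarith

/-- Probability of avoiding `j` during steps `1..L` is at most one half. -/
lemma avoid_bound (i j : V) (hij : G.Reachable i j) (H : Finset V)
    (hH : ∀ v, v ∈ H ↔ G.Reachable j v) :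
    iterF (fun v u => if u = j then 0 else mhMatrix G v u) (12 * H.card ^ 2) i ≤ 1 / 2 := by
  set Q : V → V → ℝ := fun v u => if u = j then 0 else mhMatrix G v u with hQ
  have hQ0 : ∀ v u, 0 ≤ Q v u := by
    intro v u; simp only [hQ]; split_ifs
    · exact le_rfl
    · exact mh_nonneg G v u
  have hQP : ∀ v u, Q v u ≤ mhMatrix G v u := by
    intro v u; simp only [hQ]; split_ifs
    · exact mh_nonneg G v u
    · exact le_rfl
  have hF0 : ∀ t v, 0 ≤ iterF Q t v := by
    intro t
    induction t with
    | zero => intro v; simp [iterF]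
    | succ t ih => intro v; exact Finset.sum_nonneg fun u _ => mul_nonneg (hQ0 v u) (ih u)
  have hFd1 : ∀ t v, iterF Q (t + 1) v ≤ iterF Q t v := by
    intro t
    induction t with
    | zero =>
      intro v
      simp only [iterF, mul_one]
      rw [← mh_row G v]
      exact Finset.sum_le_sum fun u _ => hQP v u
    | succ t ih =>
      intro v
      exact Finset.sum_le_sum fun u _ => mul_le_mul_of_nonneg_left (ih u) (hQ0 v u)
  have hFd : ∀ v, Antitone (fun t => iterF Q t v) := fun v => antitone_nat_of_succ_le fun t => hFd1 t v
  set L := 12 * H.card ^ 2 with hL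
  set S : V → ℝ := fun v => ∑ t ∈ Finset.range L, iterF Q t v with hS
  have hS0 : ∀ v, 0 ≤ S v := fun v => Finset.sum_nonneg fun t _ => hF0 t v
  have hS1 : ∀ v, S v + iterF Q L v = 1 + ∑ u, Q v u * S u := by
    intro v
    simp only [hS]
    rw [← Finset.sum_range_succ, Finset.sum_range_succ', add_comm]
    simp only [iterF, Finset.mul_sum]
    rw [Finset.sum_comm]
  have hSL : ∀ v, L * iterF Q L v ≤ S v := by
    intro v
    have := Finset.card_nsmul_le_sum (Finset.range L) (fun t => iterF Q t v) (iterF Q L v)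
      (fun t ht => hFd v (Finset.mem_range.1 ht).le)
    simpa using this
  have hiH : i ∈ H := (hH i).2 hij.symm
  have hjH : j ∈ H := (hH j).2 (SimpleGraph.Reachable.refl j)
  have hcard : (1 : ℝ) ≤ H.card := by exact_mod_cast Finset.card_pos.2 ⟨i, hiH⟩
  have hLr : (L : ℝ) = 12 * (H.card : ℝ) ^ 2 := by rw [hL]; push_cast; ring
  suffices hh : S i ≤ 6 * (H.card : ℝ) ^ 2 by
    have := hSL i
    rw [hLr] at this
    by_contra hc
    push Not at hc
    have hpos : (0:ℝ) < 12 * (H.card : ℝ) ^ 2 := by positivity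
    have := mul_lt_mul_of_pos_left hc hpos
    linarith
  by_cases hne : i = j
  · -- return time, by stationarity of the uniform measure
    subst hne
    have h1 : ∑ v ∈ H, (S v + iterF Q L v) = ∑ v ∈ H, (1 + ∑ u, Q v u * S u) :=
      Finset.sum_congr rfl fun v _ => hS1 v
    have h2 : ∑ v ∈ H, ∑ u, Q v u * S u ≤ ∑ u ∈ H.erase i, S u := by
      rw [Finset.sum_comm]
      rw [← Finset.sum_subset (Finset.subset_univ (H.erase i))]
      · refine Finset.sum_le_sum fun u _ => ?_
        rw [← Finset.sum_mul]
        have : ∑ v ∈ H, Q v u ≤ 1 := by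
          rw [← mh_row G u]
          refine (Finset.sum_le_sum fun v _ => (hQP v u).trans (mh_symm G v u).le).trans ?_
          exact Finset.sum_le_sum_of_subset_of_nonneg (Finset.subset_univ _)
            fun v _ _ => mh_nonneg G u v
        nlinarith [hS0 u]
      · intro u _ hu
        apply Finset.sum_eq_zero
        intro v hv
        have : Q v u = 0 := by
          by_cases hui : u = i
          · simp [hQ, hui]
          · have : ¬ G.Reachable i u := by
              rw [← hH]; simpa [hui] using hu
            simp [hQ, hui, mh_zero G ((hH v).1 hv) this]
        rw [this, zero_mul]
    rw [Finset.sum_add_distrib, Finset.sum_add_distrib, ← Finset.add_sum_erase H S hiH] at h1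
    have h3 : 0 ≤ ∑ v ∈ H, iterF Q L v := Finset.sum_nonneg fun v _ => hF0 L v
    simp only [Finset.sum_const, nsmul_eq_mul, mul_one] at h1
    nlinarith
  · have := key_bound G j H hH (fun v => if v ∈ H ∧ v ≠ j then S v else 0)
      (fun v => by split_ifs; exacts [hS0 v, le_rfl]) (by simp)
      (fun v hv => by simp [hv]) (fun v hv hvj => ?_) i
    · simpa [hiH, hne] using this
    · simp only [hv, hvj, ne_eq, not_false_eq_true, and_self, if_true]
      have e : ∑ u, mhMatrix G v u * (if u ∈ H ∧ ¬ u = j then S u else 0) = ∑ u, Q v u * S u := by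
        refine Finset.sum_congr rfl fun u _ => ?_
        by_cases huj : u = j
        · simp [hQ, huj]
        · by_cases huH : u ∈ H
          · simp [hQ, huj, huH]
          · simp [hQ, huj, huH, mh_zero G ((hH v).1 hv) (fun h => huH ((hH u).2 h))]
      rw [e]
      linarith [hS1 v, hF0 L v]

end helpers

/-- Started at `i`, the Metropolis–Hastings walk hits any vertex `j` of the connected
component `H` of `i` (of size `nH`) within the first `12 * nH ^ 2` steps with
probability at least `1/2`. -/
theorem mh_hit_component_vertex {V : Type*} [Fintype V] [DecidableEq V] (G : SimpleGraph V)
    [DecidableRel G.Adj] (i j : V) (hij : G.Reachable i j)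
    (nH : ℕ) (hnH : nH = Nat.card {v : V | G.Reachable i v}) :
    prTraj (mhMatrix G) (dirac i) (12 * nH ^ 2)
      {x | ∃ s : Fin (12 * nH ^ 2 + 1), 1 ≤ s.val ∧ x s = j} ≥ 1 / 2 := by
  classical
  set H : Finset V := Finset.univ.filter (fun v => G.Reachable i v) with hHdef
  have hH : ∀ v, v ∈ H ↔ G.Reachable j v := by
    intro v
    simp only [hHdef, Finset.mem_filter, Finset.mem_univ, true_and]
    exact ⟨fun h => hij.symm.trans h, fun h => hij.trans h⟩
  have hc : nH = H.card := by
    rw [hnH, Nat.card_eq_fintype_card, ← Set.toFinset_card]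
    congr 1
    ext v; simp [hHdef]
  have hav := avoid_bound G i j hij H hH
  rw [← hc] at hav
  generalize 12 * nH ^ 2 = L at hav ⊢
  set Q : V → V → ℝ := fun v u => if u = j then 0 else mhMatrix G v u with hQ
  have hd : ∀ f : V → ℝ, ∑ v, dirac i v * f v = f i := by
    intro f; simp [dirac]
  have hone : ∀ t v, iterF (mhMatrix G) t v = 1 := by
    intro t
    induction t with
    | zero => intro v; rfl
    | succ t ih => intro v; simp only [iterF, ih, mul_one]; exact mh_row G v
  have t1 := sum_traj (mhMatrix G) L (dirac i)
  have t2 := sum_traj Q L (dirac i)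
  rw [hd] at t1 t2
  rw [hone] at t1
  have hsplit : prTraj (mhMatrix G) (dirac i) L
      {x | ∃ s : Fin (L + 1), 1 ≤ s.val ∧ x s = j} + iterF Q L i = 1 := by
    rw [← t1, ← t2, prTraj, ← Finset.sum_add_distrib]
    refine Finset.sum_congr rfl fun x _ => ?_
    by_cases hx : ∃ s : Fin (L + 1), 1 ≤ s.val ∧ x s = j
    · rw [Set.indicator_of_mem (by exact hx)]
      obtain ⟨s, hs, hxs⟩ := hx
      obtain ⟨τ, rfl⟩ := Fin.exists_succ_eq.2 (show s ≠ 0 by rintro rfl; simp at hs)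
      have : ∏ τ : Fin L, Q (x τ.castSucc) (x τ.succ) = 0 :=
        Finset.prod_eq_zero (Finset.mem_univ τ) (by simp [hQ, hxs])
      rw [this, mul_zero, add_zero]
    · rw [Set.indicator_of_notMem (by exact hx), zero_add]
      congr 1
      refine Finset.prod_congr rfl fun τ _ => ?_
      have : x τ.succ ≠ j := fun h => hx ⟨τ.succ, by simp, h⟩
      simp [hQ, this]
  linarith
end

section
/- Let i ∈ V, let H be the connected component of G containing i, and let n_H = |V(H)|. The Metropolis–Hastings walk RW(G_1) started at i visits every vertex of V(H) within the first 24·n_H²·log₂ n steps with probability at least 1 − 1/n. -/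
open Finset

section aux
set_option linter.unusedSectionVars false
variable {V : Type*} [Fintype V] [DecidableEq V]

lemma mh_symm_s1 (G : SimpleGraph V) [DecidableRel G.Adj] (a b : V) :
    mhMatrix G a b = mhMatrix G b a := by
  unfold mhMatrix
  simp only [Matrix.of_apply]
  by_cases h : a = b
  · subst h; rfl
  · rw [if_neg (Ne.symm h), if_neg h, min_comm]
    simp only [G.adj_comm a b]

lemma mh_nonneg_s1 (G : SimpleGraph V) [DecidableRel G.Adj] (a b : V) : 0 ≤ mhMatrix G a b := by
  unfold mhMatrix
  simp only [Matrix.of_apply]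
  split_ifs
  · have : ∑ w ∈ G.neighborFinset a, min ((G.degree a : ℝ))⁻¹ ((G.degree w : ℝ))⁻¹
        ≤ ∑ w ∈ G.neighborFinset a, ((G.degree a : ℝ))⁻¹ :=
      Finset.sum_le_sum fun _ _ => min_le_left _ _
    rw [Finset.sum_const, G.card_neighborFinset_eq_degree, nsmul_eq_mul] at this
    have := mul_inv_le_one (a := (G.degree a : ℝ))
    linarith
  · positivity
  · exact le_rfl

lemma mh_rowsum (G : SimpleGraph V) [DecidableRel G.Adj] (a : V) :
    ∑ b, mhMatrix G a b = 1 := by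
  rw [← Finset.add_sum_erase _ _ (Finset.mem_univ a)]
  have h1 : ∑ b ∈ univ.erase a, mhMatrix G a b
      = ∑ b ∈ univ.erase a, if G.Adj a b then
          min ((G.degree a : ℝ))⁻¹ ((G.degree b : ℝ))⁻¹ else 0 := by
    refine Finset.sum_congr rfl fun b hb => ?_
    simp only [mhMatrix, Matrix.of_apply]
    rw [if_neg (Finset.ne_of_mem_erase hb)]
  have h2 : (univ.erase a).filter (fun b => G.Adj a b) = G.neighborFinset a := by
    ext b
    simp only [Finset.mem_filter, Finset.mem_erase, SimpleGraph.mem_neighborFinset,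
      Finset.mem_univ, and_true]
    exact ⟨fun h => h.2, fun h => ⟨h.ne', h⟩⟩
  rw [h1, ← Finset.sum_filter, h2]
  simp [mhMatrix]

lemma mh_reach (G : SimpleGraph V) [DecidableRel G.Adj] (a b : V) (h : ¬ G.Reachable a b) :
    mhMatrix G a b = 0 := by
  simp only [mhMatrix, Matrix.of_apply]
  rw [if_neg, if_neg]
  · intro h'; exact h h'.reachable
  · rintro rfl; exact h (SimpleGraph.Reachable.refl _)

/-- Probability of staying in `A` for `L` steps. -/
noncomputable def stay (P : Matrix V V ℝ) (A : V → Prop) [DecidablePred A] : ℕ → V → ℝ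
  | 0, x => if A x then 1 else 0
  | k + 1, x => if A x then ∑ y, P x y * stay P A k y else 0

lemma prTraj_stay (P : Matrix V V ℝ) (A : V → Prop) [DecidablePred A] (L : ℕ) (i : V) :
    prTraj P (dirac i) L {x | ∀ s, A (x s)} = stay P A L i := by
  classical
  induction L generalizing i with
  | zero =>
    unfold prTraj stay
    rw [← (Equiv.funUnique (Fin 1) V).symm.sum_comp]
    simp [Set.indicator_apply, dirac]
    rw [Finset.sum_eq_single i]
    · simp
    · intro b _ hb; simp [hb]
    · simp
  | succ L ih =>
    unfold stay
    simp only [← ih]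
    unfold prTraj
    rw [← (Fin.consEquiv (fun _ : Fin (L + 2) => V)).sum_comp, Fintype.sum_prod_type]
    simp only [Set.indicator_apply, Set.mem_setOf_eq, Fin.consEquiv_apply, Fin.cons_zero,
      dirac, Fin.prod_univ_succ, Fin.forall_fin_succ (n := L + 1), Fin.cons_succ,
      Fin.castSucc_zero, ← Fin.succ_castSucc]
    rw [Finset.sum_eq_single i]
    · by_cases hi : A i
      · simp only [hi, true_and, if_true, Finset.mul_sum]
        rw [Finset.sum_comm]
        refine Finset.sum_congr rfl fun x _ => ?_
        rw [Finset.sum_eq_single (x 0)]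
        · by_cases hx : ∀ s, A (x s)
          · rw [if_pos hx, if_pos hx]; simp
          · rw [if_neg hx, if_neg hx]; simp
        · intro b _ hb
          rw [if_neg (Ne.symm hb)]
          simp
        · simp
      · simp [hi]
    · intro b _ hb
      simp [hb]
    · simp

lemma stay_univ (P : Matrix V V ℝ) (hP : ∀ a, ∑ b, P a b = 1) (L : ℕ) (i : V) :
    stay P (fun _ => True) L i = 1 := by
  induction L generalizing i with
  | zero => simp [stay]
  | succ L ih => simp [stay, ih, hP]

lemma stay_nonneg (P : Matrix V V ℝ) (hP : ∀ a b, 0 ≤ P a b) (A : V → Prop) [DecidablePred A]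
    (L : ℕ) (i : V) : 0 ≤ stay P A L i := by
  induction L generalizing i with
  | zero => unfold stay; split_ifs <;> norm_num
  | succ L ih =>
    unfold stay; split_ifs
    · exact Finset.sum_nonneg fun y _ => mul_nonneg (hP _ _) (ih _)
    · exact le_rfl

lemma path_bound (G : SimpleGraph V) [DecidableRel G.Adj] (v x : V) (hr : G.Reachable v x)
    (g : V → ℝ) (hg : g v = 0) (C : Finset V) (hC : ∀ w, G.Reachable v w → w ∈ C) :
    g x ^ 2 ≤ 6 * (C.card : ℝ) * ∑ a, ∑ b, mhMatrix G a b * (g a - g b) ^ 2 := by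
  classical
  obtain ⟨p, hp⟩ := hr.exists_walk_length_eq_dist
  set L := p.length with hL
  set u : ℕ → V := fun j => p.getVert j with hu
  have hru : ∀ j, G.Reachable v (u j) := fun j => ⟨p.take j⟩
  have hdist : ∀ j ≤ L, G.dist v (u j) = j := by
    intro j hj
    have h1 : G.dist v (u j) ≤ j := by
      refine (SimpleGraph.dist_le (p.take j)).trans ?_
      rw [SimpleGraph.Walk.take_length]; exact min_le_left _ _
    have h2 : G.dist (u j) x ≤ L - j := by
      refine (SimpleGraph.dist_le (p.drop j)).trans ?_
      rw [SimpleGraph.Walk.drop_length]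
    have h3 : G.dist v x ≤ G.dist v (u j) + G.dist (u j) x :=
      SimpleGraph.Reachable.dist_triangle_left (hru j) x
    omega
  have hadj : ∀ j < L, G.Adj (u j) (u (j + 1)) := fun j hj => p.adj_getVert_succ hj
  have hinj : ∀ j ≤ L, ∀ k ≤ L, u j = u k → j = k := by
    intro j hj k hk h
    rw [← hdist j hj, ← hdist k hk, h]
  -- degree sum
  have hdeg : ∑ j ∈ Finset.range (L + 1), G.degree (u j) ≤ 3 * C.card := by
    have e1 : ∀ j ∈ Finset.range (L + 1), G.degree (u j)
        = ∑ w ∈ C, if G.Adj (u j) w then 1 else 0 := by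
      intro j _
      rw [← G.card_neighborFinset_eq_degree, Finset.sum_boole]
      simp only [Nat.cast_id]
      congr 1
      ext w
      simp only [SimpleGraph.mem_neighborFinset, Finset.mem_filter]
      exact ⟨fun h => ⟨hC w ((hru j).trans h.reachable), h⟩, fun h => h.2⟩
    rw [Finset.sum_congr rfl e1, Finset.sum_comm, mul_comm, ← smul_eq_mul]
    refine Finset.sum_le_card_nsmul _ _ _ fun w _ => ?_
    rw [Finset.sum_boole]
    simp only [Nat.cast_id]
    have : (Finset.range (L + 1)).filter (fun j => G.Adj (u j) w)
        ⊆ Finset.Icc (G.dist v w - 1) (G.dist v w + 1) := by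
      intro j hj
      simp only [Finset.mem_filter, Finset.mem_range, Finset.mem_Icc] at hj ⊢
      obtain ⟨hj, ha⟩ := hj
      have h0 := hdist j (by omega)
      have h1 : G.dist v w ≤ G.dist v (u j) + G.dist (u j) w :=
        SimpleGraph.Reachable.dist_triangle_left (hru j) w
      have h2 : G.dist v (u j) ≤ G.dist v w + G.dist w (u j) :=
        SimpleGraph.Reachable.dist_triangle_left ((hru j).trans ha.reachable) _
      have h3 : G.dist (u j) w = 1 := SimpleGraph.dist_eq_one_iff_adj.2 ha
      have h4 : G.dist w (u j) = 1 := SimpleGraph.dist_eq_one_iff_adj.2 ha.symm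
      omega
    refine (Finset.card_le_card this).trans ?_
    rw [Nat.card_Icc]
    omega
  -- the telescoping sum
  have htel : ∑ j ∈ Finset.range L, (g (u (j + 1)) - g (u j)) = g x := by
    rw [Finset.sum_range_sub (fun j => g (u j))]
    simp [hu, hL, hg]
  have hP : ∀ j < L, mhMatrix G (u j) (u (j + 1))
      = min ((G.degree (u j) : ℝ))⁻¹ ((G.degree (u (j + 1)) : ℝ))⁻¹ := by
    intro j hj
    simp only [mhMatrix, Matrix.of_apply]
    rw [if_neg (hadj j hj).ne', if_pos (hadj j hj)]
  have hpos : ∀ j < L, 0 < (G.degree (u j) : ℝ) ∧ 0 < (G.degree (u (j + 1)) : ℝ) := by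
    intro j hj
    have := hadj j hj
    exact ⟨by exact_mod_cast (G.degree_pos_iff_exists_adj _).2 ⟨_, this⟩,
      by exact_mod_cast (G.degree_pos_iff_exists_adj _).2 ⟨_, this.symm⟩⟩
  have hPpos : ∀ j < L, 0 < mhMatrix G (u j) (u (j + 1)) := by
    intro j hj
    rw [hP j hj]
    exact lt_min (inv_pos.2 (hpos j hj).1) (inv_pos.2 (hpos j hj).2)
  have hCS := Finset.sum_sq_le_sum_mul_sum_of_sq_eq_mul (Finset.range L)
    (r := fun j => g (u (j + 1)) - g (u j))
    (f := fun j => (mhMatrix G (u j) (u (j + 1)))⁻¹)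
    (g := fun j => mhMatrix G (u j) (u (j + 1)) * (g (u j) - g (u (j + 1))) ^ 2)
    (fun j _ => inv_nonneg.2 (mh_nonneg_s1 G _ _))
    (fun j _ => mul_nonneg (mh_nonneg_s1 G _ _) (sq_nonneg _))
    (fun j hj => by
      have := (hPpos j (Finset.mem_range.1 hj)).ne'
      field_simp
      ring)
  rw [htel] at hCS
  refine hCS.trans (mul_le_mul ?_ ?_ ?_ (by positivity))
  · have h1 : ∑ j ∈ Finset.range L, (mhMatrix G (u j) (u (j + 1)))⁻¹
        ≤ ∑ j ∈ Finset.range L, ((G.degree (u j) : ℝ) + (G.degree (u (j + 1)) : ℝ)) := by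
      refine Finset.sum_le_sum fun j hj => ?_
      have hj := Finset.mem_range.1 hj
      rw [hP j hj]
      obtain ⟨ha, hb⟩ := hpos j hj
      rcases min_choice ((G.degree (u j) : ℝ))⁻¹ ((G.degree (u (j + 1)) : ℝ))⁻¹ with h | h <;>
        rw [h, inv_inv] <;> linarith
    rw [Finset.sum_add_distrib] at h1
    have hd : ∑ j ∈ Finset.range (L + 1), (G.degree (u j) : ℝ) ≤ 3 * C.card := by
      exact_mod_cast hdeg
    have h2 := hd
    rw [Finset.sum_range_succ] at h2
    have h3 := hd
    rw [Finset.sum_range_succ'] at h3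
    have h4 : (0 : ℝ) ≤ (G.degree (u L) : ℝ) := by positivity
    have h5 : (0 : ℝ) ≤ (G.degree (u 0) : ℝ) := by positivity
    linarith
  · rw [← Fintype.sum_prod_type']
    have := Finset.sum_image (s := Finset.range L) (g := fun j => (u j, u (j + 1)))
      (f := fun z : V × V => mhMatrix G z.1 z.2 * (g z.1 - g z.2) ^ 2) (by
        intro j hj k hk h
        simp only [Finset.coe_range, Set.mem_Iio] at hj hk
        exact hinj j hj.le k hk.le (Prod.ext_iff.1 h).1)
    rw [← this]
    exact Finset.sum_le_sum_of_subset_of_nonneg (Finset.subset_univ _)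
      fun z _ _ => mul_nonneg (mh_nonneg_s1 G _ _) (sq_nonneg _)
  · exact Finset.sum_nonneg fun j _ => mul_nonneg (mh_nonneg_s1 G _ _) (sq_nonneg _)

lemma energy_eq (P : Matrix V V ℝ) (hs : ∀ a b, P a b = P b a) (h1 : ∀ a, ∑ b, P a b = 1)
    (g : V → ℝ) : ∑ a, ∑ b, P a b * (g a - g b) ^ 2
      = 2 * (∑ a, g a ^ 2 - ∑ a, ∑ b, g a * P a b * g b) := by
  have e1 : ∑ a, ∑ b, P a b * g a ^ 2 = ∑ a, g a ^ 2 := by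
    refine Finset.sum_congr rfl fun a _ => ?_
    rw [← Finset.sum_mul, h1, one_mul]
  have e2 : ∑ a, ∑ b, P a b * g b ^ 2 = ∑ a, g a ^ 2 := by
    rw [Finset.sum_comm, ← e1]
    exact Finset.sum_congr rfl fun a _ => Finset.sum_congr rfl fun b _ => by rw [hs]
  have e3 : ∑ a, ∑ b, P a b * (g a - g b) ^ 2 = ∑ a, ∑ b, P a b * g a ^ 2
      + ∑ a, ∑ b, P a b * g b ^ 2 - 2 * ∑ a, ∑ b, g a * P a b * g b := by
    simp only [Finset.mul_sum, ← Finset.sum_add_distrib, ← Finset.sum_sub_distrib]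
    exact Finset.sum_congr rfl fun a _ => Finset.sum_congr rfl fun b _ => by ring
  rw [e3, e1, e2]; ring

lemma rayleigh (G : SimpleGraph V) [DecidableRel G.Adj] (v : V)
    (g : V → ℝ) (hg : g v = 0) (C : Finset V) (hC : ∀ w, G.Reachable v w ↔ w ∈ C)
    (hsupp : ∀ w, w ∉ C → g w = 0) :
    ∑ a, ∑ b, g a * mhMatrix G a b * g b
      ≤ (1 - 1 / (12 * (C.card : ℝ) ^ 2)) * ∑ a, g a ^ 2 := by
  have hpb := fun x (hx : x ∈ C) => path_bound G v x ((hC x).2 hx) g hg C fun w => (hC w).1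
  rw [energy_eq _ (mh_symm_s1 G) (mh_rowsum G)] at hpb
  have h1 : ∑ a ∈ C, g a ^ 2 = ∑ a, g a ^ 2 :=
    Finset.sum_subset (Finset.subset_univ _) fun w _ hw => by simp [hsupp w hw]
  have h2 := Finset.sum_le_card_nsmul C _ _ hpb
  rw [h1, nsmul_eq_mul] at h2
  have hc : 0 < (C.card : ℝ) := by
    exact_mod_cast Finset.card_pos.2 ⟨v, (hC v).1 (SimpleGraph.Reachable.refl _)⟩
  have h3 : (∑ a, g a ^ 2) / (12 * (C.card : ℝ) ^ 2) ≤
      ∑ a, g a ^ 2 - ∑ a, ∑ b, g a * mhMatrix G a b * g b := by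
    rw [div_le_iff₀ (by positivity)]
    linarith
  have h4 : (1 - 1 / (12 * (C.card : ℝ) ^ 2)) * ∑ a, g a ^ 2
    = ∑ a, g a ^ 2 - (∑ a, g a ^ 2) / (12 * (C.card : ℝ) ^ 2) := by ring
  rw [h4]; linarith

lemma rayleigh_bilin (P : Matrix V V ℝ) (hs : ∀ a b, P a b = P b a) (hP : ∀ a b, 0 ≤ P a b)
    (S : V → Prop) (l : ℝ) (hR : ∀ g : V → ℝ, (∀ w, ¬ S w → g w = 0) →
      ∑ a, ∑ b, g a * P a b * g b ≤ l * ∑ a, g a ^ 2)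
    (f g : V → ℝ) (hf : ∀ w, ¬ S w → f w = 0) (hg : ∀ w, ¬ S w → g w = 0) :
    2 * ∑ a, ∑ b, f a * P a b * g b ≤ l * (∑ a, f a ^ 2 + ∑ a, g a ^ 2) := by
  have h1 := hR (fun a => f a + g a) (fun w hw => by simp [hf w hw, hg w hw])
  have h2 := hR (fun a => |f a - g a|) (fun w hw => by simp [hf w hw, hg w hw])
  simp only [sq_abs] at h2
  have h3 : -∑ a, ∑ b, (f a - g a) * P a b * (f b - g b)
      ≤ ∑ a, ∑ b, |f a - g a| * P a b * |f b - g b| := by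
    simp only [← Finset.sum_neg_distrib]
    refine Finset.sum_le_sum fun a _ => Finset.sum_le_sum fun b _ => ?_
    have : |f a - g a| * P a b * |f b - g b| = |(f a - g a) * P a b * (f b - g b)| := by
      rw [abs_mul, abs_mul, abs_of_nonneg (hP a b)]
    rw [this]
    exact neg_le_abs _
  have h4 : ∑ a, ∑ b, (f a + g a) * P a b * (f b + g b)
      - ∑ a, ∑ b, (f a - g a) * P a b * (f b - g b)
      = 2 * ∑ a, ∑ b, f a * P a b * g b + 2 * ∑ a, ∑ b, g a * P a b * f b := by
    simp only [Finset.mul_sum, ← Finset.sum_add_distrib, ← Finset.sum_sub_distrib]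
    exact Finset.sum_congr rfl fun a _ => Finset.sum_congr rfl fun b _ => by ring
  have h5 : ∑ a, ∑ b, g a * P a b * f b = ∑ a, ∑ b, f a * P a b * g b := by
    rw [Finset.sum_comm]
    exact Finset.sum_congr rfl fun a _ => Finset.sum_congr rfl fun b _ => by rw [hs]; ring
  have h6 : ∑ a, (f a + g a) ^ 2 + ∑ a, (f a - g a) ^ 2
      = 2 * (∑ a, f a ^ 2 + ∑ a, g a ^ 2) := by
    simp only [Finset.mul_sum, ← Finset.sum_add_distrib]
    exact Finset.sum_congr rfl fun a _ => by ring
  rw [h5] at h4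
  have h7 : l * (∑ a, (f a + g a) ^ 2) + l * ∑ a, (f a - g a) ^ 2
      = 2 * (l * (∑ a, f a ^ 2 + ∑ a, g a ^ 2)) := by
    rw [← mul_add, h6]; ring
  linarith

lemma stay_decay (G : SimpleGraph V) [DecidableRel G.Adj] (v : V)
    (C : Finset V) (hC : ∀ w, G.Reachable v w ↔ w ∈ C) (k : ℕ) :
    ∑ a, (if a ∈ C then stay (mhMatrix G) (fun x => x ≠ v) k a else 0) ^ 2
      ≤ ((1 - 1 / (12 * (C.card : ℝ) ^ 2)) ^ 2) ^ k * C.card := by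
  set l := 1 - 1 / (12 * (C.card : ℝ) ^ 2) with hl
  have hc : 1 ≤ (C.card : ℝ) := by
    exact_mod_cast Finset.card_pos.2 ⟨v, (hC v).1 (SimpleGraph.Reachable.refl _)⟩
  have hl0 : 0 < l := by
    rw [hl, sub_pos, div_lt_one (by positivity)]
    nlinarith
  set w : ℕ → V → ℝ := fun k a =>
    if a ∈ C then stay (mhMatrix G) (fun x => x ≠ v) k a else 0 with hw
  change ∑ a, (w k a) ^ 2 ≤ _
  have hv : ∀ k, w k v = 0 := by
    intro k; simp only [hw]; cases k <;> simp [stay]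
  have hout : ∀ k a, ¬ (a ∈ C ∧ a ≠ v) → w k a = 0 := by
    intro k a ha
    by_cases h : a = v
    · rw [h]; exact hv k
    · simp only [hw]; rw [if_neg]; tauto
  induction k with
  | zero =>
    rw [pow_zero, one_mul]
    have : ∑ a, (w 0 a) ^ 2 ≤ ∑ a, if a ∈ C then (1 : ℝ) else 0 := by
      refine Finset.sum_le_sum fun a _ => ?_
      simp only [hw, stay]
      split_ifs <;> norm_num
    simpa using this
  | succ k ih =>
    have hrec : ∀ a, w (k + 1) a ^ 2 = ∑ b, w (k + 1) a * mhMatrix G a b * w k b := by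
      intro a
      by_cases ha : a ∈ C ∧ a ≠ v
      · have : w (k + 1) a = ∑ b, mhMatrix G a b * w k b := by
          simp only [hw]
          rw [if_pos ha.1, stay, if_pos ha.2]
          refine Finset.sum_congr rfl fun b _ => ?_
          by_cases hb : b ∈ C
          · rw [if_pos hb]
          · rw [mh_reach G a b, zero_mul, zero_mul]
            intro h
            exact hb ((hC b).1 (((hC a).2 ha.1).trans h))
        calc w (k + 1) a ^ 2 = w (k + 1) a * ∑ b, mhMatrix G a b * w k b := by
              rw [← this, sq]
          _ = _ := by
              rw [Finset.mul_sum]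
              exact Finset.sum_congr rfl fun b _ => by ring
      · simp [hout (k + 1) a ha]
    have hb := rayleigh_bilin (mhMatrix G) (mh_symm_s1 G) (mh_nonneg_s1 G) (fun a => a ∈ C ∧ a ≠ v) l
      (fun g hg => rayleigh G v g (hg v (by simp)) C hC (fun a ha => hg a (by tauto)))
      (w (k + 1)) (fun a => l * w k a) (hout (k + 1))
      (fun a ha => by simp [hout k a ha])
    have e1 : ∑ a, ∑ b, w (k + 1) a * mhMatrix G a b * (l * w k b)
        = l * ∑ a, w (k + 1) a ^ 2 := by
      simp only [hrec, Finset.mul_sum]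
      exact Finset.sum_congr rfl fun a _ => Finset.sum_congr rfl fun b _ => by ring
    have e2 : ∑ a, (l * w k a) ^ 2 = l ^ 2 * ∑ a, w k a ^ 2 := by
      rw [Finset.mul_sum]
      exact Finset.sum_congr rfl fun a _ => by ring
    rw [e1, e2] at hb
    have hb' : ∑ a, w (k + 1) a ^ 2 ≤ l ^ 2 * ∑ a, w k a ^ 2 := by
      have : l * (2 * ∑ a, w (k + 1) a ^ 2)
        ≤ l * (∑ a, w (k + 1) a ^ 2 + l ^ 2 * ∑ a, w k a ^ 2) := by linarith
      have := le_of_mul_le_mul_left this hl0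
      linarith
    calc _ ≤ _ := hb'
      _ ≤ l ^ 2 * ((l ^ 2) ^ k * C.card) := by gcongr
      _ = _ := by rw [pow_succ]; ring

lemma num_bound (n c : ℝ) (hc : 1 ≤ c) (hcn : c ≤ n) (t : ℕ)
    (ht : 24 * c ^ 2 * Real.logb 2 n ≤ t) :
    ((1 - 1 / (12 * c ^ 2)) ^ 2) ^ t * c ≤ (1 / n ^ 2) ^ 2 := by
  have hn : 1 ≤ n := hc.trans hcn
  have hn0 : 0 < n := by linarith
  have h0 : 0 ≤ 1 - 1 / (12 * c ^ 2) := by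
    rw [sub_nonneg, div_le_one (by positivity)]
    nlinarith
  have h1 : 1 - 1 / (12 * c ^ 2) ≤ Real.exp (-(1 / (12 * c ^ 2))) :=
    Real.one_sub_le_exp_neg _
  have hlog : 0 ≤ Real.log n := Real.log_nonneg hn
  have h2 : ((1 - 1 / (12 * c ^ 2)) ^ 2) ^ t ≤ Real.exp (-(5 * Real.log n)) := by
    rw [← pow_mul]
    refine (pow_le_pow_left₀ h0 h1 _).trans ?_
    rw [← Real.exp_nat_mul, Real.exp_le_exp]
    have hl2 : Real.log 2 < 0.8 := by
      have := Real.log_two_lt_d9; linarith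
    have hl2' : 0 < Real.log 2 := Real.log_pos (by norm_num)
    have h3 : 5 * Real.log n ≤ 4 * Real.logb 2 n := by
      rw [Real.logb, ← mul_div_assoc, le_div_iff₀ hl2']
      nlinarith
    have h4 : 4 * Real.logb 2 n ≤ 2 * t * (1 / (12 * c ^ 2)) := by
      rw [mul_one_div, le_div_iff₀ (by positivity)]
      linarith
    push_cast
    linarith
  have h5 : Real.exp (-(5 * Real.log n)) = 1 / n ^ 5 := by
    rw [Real.exp_neg, one_div]
    congr 1
    rw [show (5 : ℝ) = ((5 : ℕ) : ℝ) by norm_num, Real.exp_nat_mul, Real.exp_log hn0]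
  rw [h5] at h2
  calc _ ≤ 1 / n ^ 5 * n := by gcongr
    _ = _ := by field_simp

end aux

/-- Started at `i`, the Metropolis–Hastings walk visits every vertex of the connected
component of `i` (of size `nH`) within the first `24 * nH ^ 2 * log₂ n` steps with
probability at least `1 - 1/n`. -/
theorem mh_cover_component {V : Type*} [Fintype V] [DecidableEq V] (G : SimpleGraph V)
    [DecidableRel G.Adj] (i : V)
    (nH : ℕ) (hnH : nH = Nat.card {v : V | G.Reachable i v})
    (t : ℕ) (ht : t = ⌈(24 * (nH : ℝ) ^ 2) * Real.logb 2 (Fintype.card V)⌉₊) :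
    prTraj (mhMatrix G) (dirac i) t
      {x | ∀ v : V, G.Reachable i v → ∃ s : Fin (t + 1), x s = v} ≥
      1 - 1 / (Fintype.card V : ℝ) := by
  classical
  set C : Finset V := univ.filter (fun v => G.Reachable i v) with hCdef
  have hmem : ∀ w, w ∈ C ↔ G.Reachable i w := fun w => by simp [hCdef]
  have hcard : nH = C.card := by
    rw [hnH, Nat.card_eq_fintype_card, Fintype.card_subtype]
    rfl
  have hiC : i ∈ C := (hmem i).2 (SimpleGraph.Reachable.refl _)
  have hc1 : (1 : ℝ) ≤ C.card := by exact_mod_cast Finset.card_pos.2 ⟨i, hiC⟩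
  have hcn : (C.card : ℝ) ≤ Fintype.card V := by exact_mod_cast Finset.card_le_univ C
  have hn0 : (0 : ℝ) < Fintype.card V := by linarith
  have ht' : 24 * (C.card : ℝ) ^ 2 * Real.logb 2 (Fintype.card V) ≤ t := by
    rw [ht, hcard]; exact Nat.le_ceil _
  -- each vertex is missed with small probability
  have hmiss : ∀ v ∈ C, stay (mhMatrix G) (fun x => x ≠ v) t i
      ≤ 1 / (Fintype.card V : ℝ) ^ 2 := by
    intro v hv
    have hC : ∀ w, G.Reachable v w ↔ w ∈ C := fun w => by
      rw [hmem]
      exact ⟨fun h => ((hmem v).1 hv).trans h, fun h => ((hmem v).1 hv).symm.trans h⟩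
    have h1 := (stay_decay G v C hC t).trans (num_bound _ _ hc1 hcn t ht')
    have h2 := Finset.single_le_sum (f := fun a =>
      (if a ∈ C then stay (mhMatrix G) (fun x => x ≠ v) t a else 0) ^ 2)
      (fun a _ => sq_nonneg _) (Finset.mem_univ i)
    simp only [if_pos hiC] at h2
    exact le_of_sq_le_sq (h2.trans h1) (by positivity)
  -- union bound
  have hunion : 1 ≤ prTraj (mhMatrix G) (dirac i) t
      {x | ∀ v : V, G.Reachable i v → ∃ s : Fin (t + 1), x s = v}
      + ∑ v ∈ C, stay (mhMatrix G) (fun x => x ≠ v) t i := by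
    have h1 := stay_univ (mhMatrix G) (mh_rowsum G) t i
    rw [← h1]
    simp only [← prTraj_stay]
    unfold prTraj
    rw [Finset.sum_comm, ← Finset.sum_add_distrib]
    refine Finset.sum_le_sum fun x _ => ?_
    have hw : 0 ≤ dirac i (x 0) * ∏ τ : Fin t, mhMatrix G (x τ.castSucc) (x τ.succ) := by
      refine mul_nonneg ?_ (Finset.prod_nonneg fun _ _ => mh_nonneg_s1 G _ _)
      unfold dirac; split_ifs <;> norm_num
    simp only [Set.indicator_apply, Set.mem_setOf_eq, implies_true, if_true]
    have hs : ∀ v ∈ C, 0 ≤ if ∀ s, x s ≠ v then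
        dirac i (x 0) * ∏ τ : Fin t, mhMatrix G (x τ.castSucc) (x τ.succ) else 0 := by
      intro v _; split_ifs
      · exact hw
      · exact le_rfl
    by_cases hx : ∀ v : V, G.Reachable i v → ∃ s : Fin (t + 1), x s = v
    · rw [if_pos hx]
      have := Finset.sum_nonneg hs
      linarith
    · rw [if_neg hx, zero_add]
      push Not at hx
      obtain ⟨v, hv, hx⟩ := hx
      refine le_trans ?_ (Finset.single_le_sum hs ((hmem v).2 hv))
      rw [if_pos hx]
  have hsum := Finset.sum_le_card_nsmul C _ _ hmiss
  rw [nsmul_eq_mul] at hsum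
  have : (C.card : ℝ) * (1 / (Fintype.card V : ℝ) ^ 2) ≤ 1 / (Fintype.card V : ℝ) := by
    calc _ ≤ (Fintype.card V : ℝ) * (1 / (Fintype.card V : ℝ) ^ 2) := by gcongr
      _ = _ := by field_simp
  linarith
end

section
/- Suppose G is connected with n ≥ 2 vertices. Let d = 2m/n be the average degree and define the potential f : V → ℝ by f(u) = deg(u)/d + 1. Then for every pair of vertices u, v ∈ V, the commute time of the Metropolis–Hastings walk RW(G_f) satisfies Com_{G_f}(u,v) ≤ 2·Com_G(u,v) and Com_{G_f}(u,v) ≤ 2·Com_{G_1}(u,v), where Com_G is the commute time of the unbiased random walk on G and Com_{G_1} is the commute time of the Metropolis–Hastings walk with unit potential. -/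
open Finset
open scoped ENNReal

/-- The Metropolis–Hastings edge/self-loop weights for a potential `f`:
`w_f(v,u) = min (f v/deg v) (f u/deg u)` on edges and
`w_f(v,v) = f v − ∑_{u ∈ Γ(v)} w_f(v,u)` on self-loops. -/
noncomputable def mhWeight {V : Type*} [Fintype V] [DecidableEq V] (G : SimpleGraph V)
    [DecidableRel G.Adj] (f : V → ℝ) : V → V → ℝ := fun v u =>
  if u = v then
    f v - ∑ w ∈ G.neighborFinset v, min (f v / (G.degree v : ℝ)) (f w / (G.degree w : ℝ))
  else if G.Adj v u then min (f v / (G.degree v : ℝ)) (f u / (G.degree u : ℝ))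
  else 0

/-- Transition matrix of the Metropolis–Hastings walk `RW(G_f)`:
from `v`, move to `u` with probability `w_f(v,u) / f v`. -/
noncomputable def mhMatrixF {V : Type*} [Fintype V] [DecidableEq V] (G : SimpleGraph V)
    [DecidableRel G.Adj] (f : V → ℝ) : Matrix V V ℝ :=
  Matrix.of fun v u => mhWeight G f v u / f v

/-- Transition matrix of the unbiased random walk `RW(G)`: from `v`, move to a uniformly
random neighbor of `v`. -/
noncomputable def srwMatrix {V : Type*} [Fintype V] [DecidableEq V] (G : SimpleGraph V)
    [DecidableRel G.Adj] : Matrix V V ℝ :=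
  Matrix.of fun v u => if G.Adj v u then ((G.degree v : ℝ))⁻¹ else 0

/-- Expected hitting time `E_u T_v = ∑' t, Pr_u[T_v > t]` of `v` for the chain with
transition matrix `P` started at `u`, valued in `ℝ≥0∞`. -/
noncomputable def hitExp {V : Type*} [Fintype V] [DecidableEq V] (P : Matrix V V ℝ)
    (u v : V) : ℝ≥0∞ :=
  ∑' t : ℕ, ENNReal.ofReal (prTraj P (dirac u) t
    {x | ∀ s : Fin (t + 1), 1 ≤ s.val → x s ≠ v})

/-- Commute time `Com(u,v) = E_u T_v + E_v T_u` of the chain `P`. -/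
noncomputable def commuteTime {V : Type*} [Fintype V] [DecidableEq V] (P : Matrix V V ℝ)
    (u v : V) : ℝ≥0∞ :=
  hitExp P u v + hitExp P v u

/-- survival probabilities, by first-step recursion -/
noncomputable def surv {V : Type*} [Fintype V] [DecidableEq V] (P : Matrix V V ℝ) (v : V) :
    ℕ → V → ℝ
  | 0, _ => 1
  | t + 1, x => ∑ y, if y = v then 0 else P x y * surv P v t y

theorem prTraj_eq_surv {V : Type*} [Fintype V] [DecidableEq V] (P : Matrix V V ℝ) (v : V)
    (t : ℕ) : ∀ u : V, prTraj P (dirac u) t {x | ∀ s : Fin (t + 1), 1 ≤ s.val → x s ≠ v} =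
      surv P v t u := by
  induction t with
  | zero =>
    intro u
    unfold prTraj surv
    rw [← (Equiv.funUnique (Fin 1) V).symm.sum_comp]
    rw [Finset.sum_eq_single u]
    · rw [Set.indicator_of_mem]
      · simp [dirac, Equiv.funUnique]
      · intro s hs
        have := s.isLt
        omega
    · intro b _ hb
      apply Set.indicator_apply_eq_zero.2
      intro _
      simp [dirac, Equiv.funUnique, hb]
    · simp
  | succ t ih =>
    intro u
    rw [surv]
    simp_rw [← ih]
    unfold prTraj
    rw [← (Fin.consEquiv (fun _ : Fin (t + 1 + 1) => V)).sum_comp, Fintype.sum_prod_type,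
      Finset.sum_eq_single u]
    · have h1 : ∀ y : V, (if y = v then (0 : ℝ) else P u y * ∑ x : Fin (t + 1) → V,
          ({x | ∀ s : Fin (t + 1), 1 ≤ s.val → x s ≠ v} : Set (Fin (t + 1) → V)).indicator
            (fun z => dirac y (z 0) * ∏ τ : Fin t, P (z τ.castSucc) (z τ.succ)) x) =
          ∑ x : Fin (t + 1) → V, (if y = v then (0 : ℝ) else P u y *
          ({x | ∀ s : Fin (t + 1), 1 ≤ s.val → x s ≠ v} : Set (Fin (t + 1) → V)).indicator
            (fun z => dirac y (z 0) * ∏ τ : Fin t, P (z τ.castSucc) (z τ.succ)) x) := by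
        intro y
        split_ifs
        · simp
        · rw [Finset.mul_sum]
      simp_rw [h1]
      rw [Finset.sum_comm]
      apply Finset.sum_congr rfl
      intro x _
      rw [Finset.sum_eq_single (x 0)]
      · have hmem : (Fin.consEquiv (fun _ : Fin (t + 1 + 1) => V)) (u, x) ∈
            ({x | ∀ s : Fin (t + 1 + 1), 1 ≤ s.val → x s ≠ v} : Set (Fin (t + 1 + 1) → V)) ↔
            (x 0 ≠ v ∧ x ∈ ({x | ∀ s : Fin (t + 1), 1 ≤ s.val → x s ≠ v} :
              Set (Fin (t + 1) → V))) := by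
          simp only [Set.mem_ofPred_eq, Fin.consEquiv, Equiv.coe_fn_mk]
          constructor
          · intro h
            refine ⟨?_, ?_⟩
            · have := h (Fin.succ 0) (by simp)
              simpa using this
            · intro s _
              have := h s.succ (by simp)
              simpa using this
          · rintro ⟨h0, h⟩ s hs
            refine Fin.cases ?_ ?_ s
              (motive := fun s => 1 ≤ s.val → (Fin.cons u x : Fin (t + 1 + 1) → V) s ≠ v) hs
            · simp
            · intro i _
              rw [Fin.cons_succ]
              by_cases hi : i = 0
              · rw [hi]; exact h0
              · exact h i (Nat.one_le_iff_ne_zero.2 (fun hh => hi (Fin.ext hh)))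
        by_cases h0 : x 0 = v
        · rw [if_pos h0, Set.indicator_of_notMem]
          rw [hmem]; tauto
        · rw [if_neg h0]
          by_cases hx : x ∈ ({x | ∀ s : Fin (t + 1), 1 ≤ s.val → x s ≠ v} :
              Set (Fin (t + 1) → V))
          · rw [Set.indicator_of_mem hx, Set.indicator_of_mem (hmem.2 ⟨h0, hx⟩)]
            rw [Fin.prod_univ_succ]
            simp [dirac, Fin.consEquiv]
          · rw [Set.indicator_of_notMem hx, Set.indicator_of_notMem]
            · simp
            · rw [hmem]; tauto
      · intro b _ hb
        split_ifs
        · rfl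
        · rw [mul_eq_zero]
          right
          apply Set.indicator_apply_eq_zero.2
          intro _
          simp [dirac, hb.symm]
      · simp
    · intro b _ hb
      apply Finset.sum_eq_zero
      intro x _
      apply Set.indicator_apply_eq_zero.2
      intro _
      simp [dirac, Fin.consEquiv, hb]
    · simp

section
variable {V : Type*} [Fintype V]

/-- weighted Laplacian -/
noncomputable def lapW (w : V → V → ℝ) (φ : V → ℝ) (x : V) : ℝ := ∑ y, w x y * (φ x - φ y)

theorem energy_eq_s10 (w : V → V → ℝ) (hs : ∀ x y, w x y = w y x) (ψ φ : V → ℝ) :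
    ∑ x, ψ x * lapW w φ x = (∑ x, ∑ y, w x y * ((ψ x - ψ y) * (φ x - φ y))) / 2 := by
  have h1 : ∑ x, ψ x * lapW w φ x = ∑ x, ∑ y, w x y * (ψ x * (φ x - φ y)) := by
    apply Finset.sum_congr rfl; intro x _
    rw [lapW, Finset.mul_sum]
    apply Finset.sum_congr rfl; intro y _; ring
  have h2 : ∑ x, ψ x * lapW w φ x = ∑ x, ∑ y, w x y * (-ψ y * (φ x - φ y)) := by
    rw [h1, Finset.sum_comm]
    apply Finset.sum_congr rfl; intro x _
    apply Finset.sum_congr rfl; intro y _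
    rw [hs y x]; ring
  have h3 : ∑ x, ∑ y, w x y * ((ψ x - ψ y) * (φ x - φ y)) =
      ∑ x, ∑ y, w x y * (ψ x * (φ x - φ y)) + ∑ x, ∑ y, w x y * (-ψ y * (φ x - φ y)) := by
    simp_rw [← Finset.sum_add_distrib]
    apply Finset.sum_congr rfl; intro x _
    apply Finset.sum_congr rfl; intro y _; ring
  rw [h3, ← h1, ← h2]; ring

theorem sum_lapW (w : V → V → ℝ) (hs : ∀ x y, w x y = w y x) (φ : V → ℝ) :
    ∑ x, lapW w φ x = 0 := by
  have := energy_eq_s10 w hs (fun _ => 1) φ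
  simpa using this

theorem const_of_energy (G : SimpleGraph V) (hG : G.Connected) (w : V → V → ℝ)
    (h0 : ∀ x y, 0 ≤ w x y) (hadj : ∀ x y, G.Adj x y → 0 < w x y) (φ : V → ℝ)
    (hE : ∑ x, ∑ y, w x y * ((φ x - φ y) * (φ x - φ y)) = 0) (x y : V) : φ x = φ y := by
  have hnn : ∀ x y, 0 ≤ w x y * ((φ x - φ y) * (φ x - φ y)) := fun x y =>
    mul_nonneg (h0 x y) (mul_self_nonneg _)
  have hA : ∀ x y, G.Adj x y → φ x = φ y := by
    intro x y hxy
    have h1 := (Finset.sum_eq_zero_iff_of_nonneg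
      (fun x _ => Finset.sum_nonneg (fun y _ => hnn x y))).1 hE x (Finset.mem_univ _)
    have h2 := (Finset.sum_eq_zero_iff_of_nonneg (fun y _ => hnn x y)).1 h1 y (Finset.mem_univ _)
    rcases mul_eq_zero.1 h2 with h | h
    · exact absurd h (hadj x y hxy).ne'
    · have := mul_self_eq_zero.1 h
      linarith
  obtain ⟨p⟩ := hG.preconnected x y
  induction p with
  | nil => rfl
  | cons h _ ih => exact (hA _ _ h).trans ih

theorem exists_dirichlet [DecidableEq V] (G : SimpleGraph V) (hG : G.Connected) (w : V → V → ℝ)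
    (hs : ∀ x y, w x y = w y x)
    (h0 : ∀ x y, 0 ≤ w x y) (hadj : ∀ x y, G.Adj x y → 0 < w x y) (v : V) (b : V → ℝ) :
    ∃ g : V → ℝ, g v = 0 ∧ ∀ x, x ≠ v → lapW w g x = b x := by
  let A : (V → ℝ) →ₗ[ℝ] (V → ℝ) :=
    { toFun := fun φ x => if x = v then φ v else lapW w φ x
      map_add' := by
        intro a b
        ext x
        simp only [Pi.add_apply]
        split_ifs
        · rfl
        · simp only [lapW, ← Finset.sum_add_distrib, Pi.add_apply]
          apply Finset.sum_congr rfl; intro y _; ring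
      map_smul' := by
        intro c a
        ext x
        simp only [Pi.smul_apply, smul_eq_mul, RingHom.id_apply]
        split_ifs
        · rfl
        · simp only [lapW, Finset.mul_sum, Pi.smul_apply, smul_eq_mul]
          apply Finset.sum_congr rfl; intro y _; ring }
  have hAapp : ∀ φ x, A φ x = if x = v then φ v else lapW w φ x := fun _ _ => rfl
  have hinj : Function.Injective A := by
    rw [injective_iff_map_eq_zero]
    intro φ hφ
    have hv : φ v = 0 := by
      have := congrFun hφ v
      rw [hAapp, if_pos rfl] at this
      exact this
    have hE : ∑ x, φ x * lapW w φ x = 0 := by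
      apply Finset.sum_eq_zero
      intro x _
      by_cases hx : x = v
      · rw [hx, hv, zero_mul]
      · have := congrFun hφ x
        rw [hAapp, if_neg hx] at this
        rw [this]; simp
    rw [energy_eq_s10 w hs] at hE
    ext x
    rw [const_of_energy G hG w h0 hadj φ (by linarith) x v, hv]; rfl
  obtain ⟨g, hg⟩ := (LinearMap.injective_iff_surjective.1 hinj) (fun x => if x = v then 0 else b x)
  refine ⟨g, ?_, ?_⟩
  · have := congrFun hg v
    simpa [hAapp] using this
  · intro x hx
    have := congrFun hg x
    simpa [hAapp, hx] using this

/-- the chain is reversible with weights `w` -/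
structure RevChain [DecidableEq V] (G : SimpleGraph V) (w : V → V → ℝ) (p : V → ℝ)
    (P : Matrix V V ℝ) : Prop where
  symm : ∀ x y, w x y = w y x
  nonneg : ∀ x y, 0 ≤ w x y
  adj : ∀ x y, G.Adj x y → 0 < w x y
  sum : ∀ x, ∑ y, w x y = p x
  pos : ∀ x, 0 < p x
  mat : ∀ x y, P x y = w x y / p x

theorem hit_exists [DecidableEq V] (G : SimpleGraph V) (hG : G.Connected) (w : V → V → ℝ)
    (p : V → ℝ) (P : Matrix V V ℝ) (h : RevChain G w p P) (v : V) :
    ∃ g : V → ℝ, (∀ x, 0 ≤ g x) ∧ g v = 0 ∧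
      (∀ x, lapW w g x = p x - if x = v then ∑ z, p z else 0) ∧
      (∀ x, x ≠ v → hitExp P x v = ENNReal.ofReal (g x)) ∧
      hitExp P v v = ENNReal.ofReal ((∑ z, p z) / p v) := by
  have hP0 : ∀ x y, 0 ≤ P x y := fun x y => by
    rw [h.mat]; exact div_nonneg (h.nonneg x y) (h.pos x).le
  have hP1 : ∀ x, ∑ y, P x y = 1 := fun x => by
    simp_rw [h.mat, ← Finset.sum_div, h.sum]
    exact div_self (h.pos x).ne'
  -- relation between Laplacian and P
  have hlap : ∀ g : V → ℝ, ∀ x, lapW w g x = p x * (g x - ∑ y, P x y * g y) := by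
    intro g x
    have : ∑ y, P x y * g y = (∑ y, w x y * g y) / p x := by
      rw [Finset.sum_div]
      apply Finset.sum_congr rfl; intro y _; rw [h.mat]; ring
    rw [this, mul_sub, mul_div_cancel₀ _ (h.pos x).ne', ← h.sum, Finset.sum_mul, lapW,
      ← Finset.sum_sub_distrib]
    apply Finset.sum_congr rfl; intro y _; ring
  obtain ⟨k, hkv, hk⟩ := exists_dirichlet G hG w h.symm h.nonneg h.adj v p
  have hk0 : ∀ x, 0 ≤ k x := by
    have : Nonempty V := ⟨v⟩
    obtain ⟨z, hz⟩ := Finite.exists_min k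
    have hzv : z = v := by
      by_contra hne
      have h1 := hk z hne
      have h2 : lapW w k z ≤ 0 := Finset.sum_nonpos (fun y _ =>
        mul_nonpos_of_nonneg_of_nonpos (h.nonneg z y) (by linarith [hz y]))
      linarith [h.pos z]
    intro x
    have := hz x
    rw [hzv, hkv] at this
    exact this
  have hkeq : ∀ x, x ≠ v → k x = 1 + ∑ y, P x y * k y := by
    intro x hx
    have h1 := hk x hx
    rw [hlap] at h1
    have h2 : p x * (k x - ∑ y, P x y * k y) = p x * 1 := by linarith
    have := mul_left_cancel₀ (h.pos x).ne' h2
    linarith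
  have hS0 : ∀ t x, 0 ≤ surv P v t x := by
    intro t
    induction t with
    | zero => intro x; simp [surv]
    | succ t ih =>
      intro x
      rw [surv]
      apply Finset.sum_nonneg
      intro y _
      split_ifs
      · exact le_rfl
      · exact mul_nonneg (hP0 x y) (ih y)
  have hpart : ∀ T x, ∑ t ∈ Finset.range (T + 1), surv P v t x =
      1 + ∑ y, if y = v then 0 else P x y * ∑ t ∈ Finset.range T, surv P v t y := by
    intro T x
    rw [Finset.sum_range_succ', add_comm]
    congr 1
    simp only [surv]
    rw [Finset.sum_comm]
    apply Finset.sum_congr rfl; intro y _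
    split_ifs
    · simp
    · rw [Finset.mul_sum]
  have hbound : ∀ T x, ∑ t ∈ Finset.range T, surv P v t x ≤ 1 + ∑ y, P x y * k y := by
    intro T
    induction T with
    | zero =>
      intro x
      have : 0 ≤ ∑ y, P x y * k y := Finset.sum_nonneg (fun y _ => mul_nonneg (hP0 x y) (hk0 y))
      simp; linarith
    | succ T ih =>
      intro x
      rw [hpart]
      gcongr with y _
      split_ifs with hy
      · rw [hy, hkv, mul_zero]
      · rw [hkeq y hy]
        exact mul_le_mul_of_nonneg_left (ih y) (hP0 x y)
  have hsum : ∀ x, Summable (fun t => surv P v t x) := fun x =>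
    summable_of_sum_range_le (fun t => hS0 t x) (fun T => hbound T x)
  set H : V → ℝ := fun x => ∑' t, surv P v t x with hH
  have hH0 : ∀ x, 0 ≤ H x := fun x => tsum_nonneg (fun t => hS0 t x)
  have hhit : ∀ x, hitExp P x v = ENNReal.ofReal (H x) := by
    intro x
    unfold hitExp
    simp_rw [prTraj_eq_surv]
    rw [hH, ENNReal.ofReal_tsum_of_nonneg (fun t => hS0 t x) (hsum x)]
  set g : V → ℝ := fun x => if x = v then 0 else H x with hg
  have hHg : ∀ x, H x = 1 + ∑ y, P x y * g y := by
    intro x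
    have h1 : Filter.Tendsto (fun T => ∑ t ∈ Finset.range (T + 1), surv P v t x) Filter.atTop
        (nhds (H x)) := (Filter.tendsto_add_atTop_iff_nat 1).2 (hsum x).hasSum.tendsto_sum_nat
    have h2 : Filter.Tendsto (fun T => ∑ t ∈ Finset.range (T + 1), surv P v t x) Filter.atTop
        (nhds (1 + ∑ y, P x y * g y)) := by
      simp_rw [hpart]
      apply Filter.Tendsto.const_add
      apply tendsto_finsetSum
      intro y _
      by_cases hy : y = v
      · simp [hg, hy]
      · simp only [hg, hy, if_false]
        exact (hsum y).hasSum.tendsto_sum_nat.const_mul _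
    exact tendsto_nhds_unique h1 h2
  have hgv : g v = 0 := by simp [hg]
  have hgx : ∀ x, x ≠ v → g x = H x := fun x hx => by simp [hg, hx]
  have hL : ∀ x, x ≠ v → lapW w g x = p x := by
    intro x hx
    rw [hlap, hgx x hx, hHg x]; ring
  have hLv : lapW w g v = p v - ∑ z, p z := by
    have h1 := sum_lapW w h.symm g
    rw [← Finset.add_sum_erase _ _ (Finset.mem_univ v)] at h1 ⊢
    rw [Finset.sum_congr rfl (fun x hx => hL x (Finset.ne_of_mem_erase hx))] at h1
    linarith
  refine ⟨g, ?_, hgv, ?_, ?_, ?_⟩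
  · intro x
    by_cases hx : x = v
    · rw [hx, hgv]
    · rw [hgx x hx]; exact hH0 x
  · intro x
    by_cases hx : x = v
    · rw [hx, if_pos rfl, hLv]
    · rw [if_neg hx, hL x hx, sub_zero]
  · intro x hx
    rw [hhit, hgx x hx]
  · rw [hhit]
    congr 1
    rw [eq_div_iff (h.pos v).ne']
    rw [hlap, hgv] at hLv
    rw [hHg]
    linarith

theorem commute_exists [DecidableEq V] (G : SimpleGraph V) (hG : G.Connected) (w : V → V → ℝ)
    (p : V → ℝ) (P : Matrix V V ℝ) (h : RevChain G w p P) (u v : V) (huv : u ≠ v) :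
    ∃ φ : V → ℝ, commuteTime P u v = ENNReal.ofReal ((∑ z, p z) * (φ u - φ v)) ∧
      ∀ x, lapW w φ x = (if x = u then 1 else 0) - (if x = v then 1 else 0) := by
  obtain ⟨a, ha0, hav, haL, haH, -⟩ := hit_exists G hG w p P h v
  obtain ⟨b, hb0, hbu, hbL, hbH, -⟩ := hit_exists G hG w p P h u
  have hW : 0 < ∑ z, p z := Finset.sum_pos (fun z _ => h.pos z) ⟨u, Finset.mem_univ u⟩
  refine ⟨fun x => (a x - b x) / ∑ z, p z, ?_, ?_⟩
  · rw [commuteTime, haH u huv, hbH v huv.symm, ← ENNReal.ofReal_add (ha0 u) (hb0 v)]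
    congr 1
    beta_reduce
    rw [hav, hbu]
    field_simp
    ring
  · intro x
    have : lapW w (fun x => (a x - b x) / ∑ z, p z) x =
        (lapW w a x - lapW w b x) / ∑ z, p z := by
      simp only [lapW]
      rw [← Finset.sum_sub_distrib, Finset.sum_div]
      apply Finset.sum_congr rfl; intro y _; ring
    rw [this, haL, hbL]
    split_ifs <;> field_simp <;> ring

theorem commute_le [DecidableEq V] (G : SimpleGraph V) (hG : G.Connected)
    (w w' : V → V → ℝ) (p p' : V → ℝ) (P P' : Matrix V V ℝ) (h : RevChain G w p P)
    (h' : RevChain G w' p' P') (hw : ∀ x y, x ≠ y → w' x y ≤ w x y) (hp : ∀ x, p' x ≤ p x)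
    (hW : ∑ z, p z = 2 * ∑ z, p' z) (u v : V) :
    commuteTime P u v ≤ 2 * commuteTime P' u v := by
  have hW' : 0 ≤ ∑ z, p' z := Finset.sum_nonneg (fun z _ => (h'.pos z).le)
  have h2 : (2 : ℝ≥0∞) = ENNReal.ofReal 2 := by simp
  by_cases huv : u = v
  · subst huv
    obtain ⟨-, -, -, -, -, e⟩ := hit_exists G hG w p P h u
    obtain ⟨-, -, -, -, -, e'⟩ := hit_exists G hG w' p' P' h' u
    have key : hitExp P u u ≤ 2 * hitExp P' u u := by
      rw [e, e', h2, ← ENNReal.ofReal_mul (by norm_num)]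
      apply ENNReal.ofReal_le_ofReal
      rw [hW, ← mul_div_assoc]
      exact div_le_div_of_nonneg_left (by linarith) (h'.pos u) (hp u)
    rw [commuteTime, commuteTime, mul_add]
    exact add_le_add key key
  · obtain ⟨φ, e, hL⟩ := commute_exists G hG w p P h u v huv
    obtain ⟨φ', e', hL'⟩ := commute_exists G hG w' p' P' h' u v huv
    rw [e, e', h2, ← ENNReal.ofReal_mul (by norm_num), hW]
    apply ENNReal.ofReal_le_ofReal
    have hpair : ∀ ψ : V → ℝ, ∑ x, ψ x * ((if x = u then (1 : ℝ) else 0) -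
        (if x = v then 1 else 0)) = ψ u - ψ v := by
      intro ψ
      simp [mul_sub, Finset.sum_sub_distrib]
    have E1 := energy_eq_s10 w h.symm φ φ
    have E2 := energy_eq_s10 w' h'.symm φ φ'
    have E3 := energy_eq_s10 w' h'.symm φ' φ'
    simp_rw [hL, hpair] at E1
    simp_rw [hL', hpair] at E2 E3
    have hmono : ∑ x, ∑ y, (2 * (w' x y * ((φ x - φ y) * (φ' x - φ' y)))) ≤
        ∑ x, ∑ y, (w x y * ((φ x - φ y) * (φ x - φ y)) +
          w' x y * ((φ' x - φ' y) * (φ' x - φ' y))) := by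
      apply Finset.sum_le_sum; intro x _
      apply Finset.sum_le_sum; intro y _
      by_cases hxy : x = y
      · simp [hxy]
      · have i1 := mul_nonneg (h'.nonneg x y) (sq_nonneg ((φ x - φ y) - (φ' x - φ' y)))
        have i2 := mul_le_mul_of_nonneg_right (hw x y hxy) (mul_self_nonneg (φ x - φ y))
        nlinarith
    simp_rw [Finset.sum_add_distrib, ← Finset.mul_sum] at hmono
    have : φ u - φ v ≤ φ' u - φ' v := by linarith
    nlinarith
end

theorem sum_offdiag {V : Type*} [Fintype V] [DecidableEq V] (G : SimpleGraph V)
    [DecidableRel G.Adj] (F : V → ℝ) (x : V) :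
    ∑ y, (if G.Adj x y then F y else 0) = ∑ y ∈ G.neighborFinset x, F y := by
  rw [← Finset.sum_filter]
  congr 1
  ext y
  simp

theorem mh_rev {V : Type*} [Fintype V] [DecidableEq V] (G : SimpleGraph V)
    [DecidableRel G.Adj] (hd : ∀ x, 0 < G.degree x) (f : V → ℝ) (hf : ∀ x, 0 < f x) :
    RevChain G (mhWeight G f) f (mhMatrixF G f) where
  symm x y := by
    unfold mhWeight
    by_cases h : x = y
    · rw [h]
    · rw [if_neg h, if_neg (Ne.symm h), min_comm]
      simp only [G.adj_comm]
  nonneg x y := by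
    have hnn : ∀ z, 0 ≤ f z / (G.degree z : ℝ) := fun z => div_nonneg (hf z).le (by positivity)
    unfold mhWeight
    split_ifs
    · have h1 : ∑ z ∈ G.neighborFinset x, min (f x / (G.degree x : ℝ)) (f z / (G.degree z : ℝ))
          ≤ ∑ z ∈ G.neighborFinset x, f x / (G.degree x : ℝ) :=
        Finset.sum_le_sum (fun z _ => min_le_left _ _)
      have hdx : (0 : ℝ) < G.degree x := by exact_mod_cast hd x
      rw [Finset.sum_const, G.card_neighborFinset_eq_degree, nsmul_eq_mul,
        mul_div_cancel₀ _ hdx.ne'] at h1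
      linarith
    · exact le_min (hnn x) (hnn y)
    · exact le_rfl
  adj x y h := by
    have hnn : ∀ z, 0 < f z / (G.degree z : ℝ) := fun z =>
      div_pos (hf z) (by exact_mod_cast hd z)
    unfold mhWeight
    rw [if_neg h.ne', if_pos h]
    exact lt_min (hnn x) (hnn y)
  sum x := by
    have : ∀ y, mhWeight G f x y = (if y = x then
        f x - ∑ w ∈ G.neighborFinset x, min (f x / (G.degree x : ℝ)) (f w / (G.degree w : ℝ))
        else 0) + (if G.Adj x y then min (f x / (G.degree x : ℝ)) (f y / (G.degree y : ℝ))
          else 0) := by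
      intro y
      unfold mhWeight
      by_cases h : y = x
      · subst h; simp
      · simp [h]
    simp_rw [this]
    rw [Finset.sum_add_distrib, sum_offdiag G
      (fun y => min (f x / (G.degree x : ℝ)) (f y / (G.degree y : ℝ)))]
    simp
  pos := hf
  mat x y := rfl

theorem srw_rev {V : Type*} [Fintype V] [DecidableEq V] (G : SimpleGraph V)
    [DecidableRel G.Adj] (hd : ∀ x, 0 < G.degree x) (d : ℝ) (hd0 : 0 < d) :
    RevChain G (fun x y => if G.Adj x y then 1 / d else 0) (fun x => (G.degree x : ℝ) / d)
      (srwMatrix G) where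
  symm x y := by simp only [G.adj_comm]
  nonneg x y := by split_ifs <;> positivity
  adj x y h := by rw [if_pos h]; positivity
  sum x := by
    rw [sum_offdiag G (fun _ => 1 / d), Finset.sum_const, G.card_neighborFinset_eq_degree,
      nsmul_eq_mul]
    ring
  pos x := div_pos (by exact_mod_cast hd x) hd0
  mat x y := by
    have hdx : (0 : ℝ) < G.degree x := by exact_mod_cast hd x
    simp only [srwMatrix, Matrix.of_apply]
    split_ifs
    · field_simp
    · simp

/-- With the potential `f(u) = deg u / d + 1`, where `d = 2m/n` is the average degree,
the commute time of `RW(G_f)` between any two vertices is at most twice the commute time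
of the unbiased random walk `RW(G)`, and at most twice the commute time of the
unit-potential Metropolis–Hastings walk `RW(G_1)`. -/
theorem mh_tuned_commute {V : Type*} [Fintype V] [DecidableEq V] (G : SimpleGraph V)
    [DecidableRel G.Adj] (hG : G.Connected) (hn : 2 ≤ Fintype.card V) (u v : V) :
    commuteTime (mhMatrixF G (fun w =>
          (G.degree w : ℝ) / (2 * (G.edgeFinset.card : ℝ) / (Fintype.card V : ℝ)) + 1)) u v ≤
        2 * commuteTime (srwMatrix G) u v ∧
      commuteTime (mhMatrixF G (fun w =>
          (G.degree w : ℝ) / (2 * (G.edgeFinset.card : ℝ) / (Fintype.card V : ℝ)) + 1)) u v ≤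
        2 * commuteTime (mhMatrixF G (fun _ => 1)) u v := by
  have hnt : Nontrivial V := Fintype.one_lt_card_iff_nontrivial.1 (by omega)
  have hd : ∀ x, 0 < G.degree x := fun x => hG.preconnected.degree_pos_of_nontrivial x
  have hn0 : (0 : ℝ) < Fintype.card V := by
    have : 0 < Fintype.card V := by omega
    exact_mod_cast this
  have hsd : ∑ x, (G.degree x : ℝ) = 2 * (G.edgeFinset.card : ℝ) := by
    exact_mod_cast G.sum_degrees_eq_twice_card_edges
  have hm : (0 : ℝ) < 2 * (G.edgeFinset.card : ℝ) := by
    rw [← hsd]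
    exact Finset.sum_pos (fun x _ => by exact_mod_cast hd x) Finset.univ_nonempty
  set d : ℝ := 2 * (G.edgeFinset.card : ℝ) / (Fintype.card V : ℝ) with hdd
  have hd0 : 0 < d := div_pos hm hn0
  have hS1 : ∑ x, (G.degree x : ℝ) / d = Fintype.card V := by
    rw [← Finset.sum_div, hsd, hdd, div_div_cancel₀ hm.ne']
  have hS : ∑ x, ((G.degree x : ℝ) / d + 1) = 2 * Fintype.card V := by
    rw [Finset.sum_add_distrib, hS1]
    simp; ring
  have hdeg : ∀ x, 0 < (G.degree x : ℝ) := fun x => by exact_mod_cast hd x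
  have hf : ∀ x, 0 < (G.degree x : ℝ) / d + 1 := fun x => by positivity
  have R := mh_rev G hd (fun x => (G.degree x : ℝ) / d + 1) hf
  have hw : ∀ z, ((G.degree z : ℝ) / d + 1) / G.degree z = 1 / d + 1 / G.degree z := by
    intro z
    have := hdeg z
    field_simp
  constructor
  · refine commute_le G hG _ _ _ _ _ _ R (srw_rev G hd d hd0) ?_ ?_ ?_ u v
    · intro x y hxy
      simp only [mhWeight]
      rw [if_neg hxy.symm]
      split_ifs
      · rw [hw, hw]
        have h1 : (0 : ℝ) ≤ 1 / G.degree x := by positivity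
        have h2 : (0 : ℝ) ≤ 1 / G.degree y := by positivity
        exact le_min (by linarith) (by linarith)
      · exact le_rfl
    · intro x; simp
    · rw [hS, hS1]
  · refine commute_le G hG _ _ _ _ _ _ R (mh_rev G hd (fun _ => 1) (fun _ => one_pos)) ?_ ?_ ?_ u v
    · intro x y hxy
      simp only [mhWeight]
      rw [if_neg hxy.symm, if_neg hxy.symm]
      split_ifs
      · rw [hw, hw]
        have h1 : (0 : ℝ) ≤ 1 / d := by positivity
        exact min_le_min (by linarith) (by linarith)
      · exact le_rfl
    · intro x
      have : 0 ≤ (G.degree x : ℝ) / d := by positivity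
      linarith
    · rw [hS]; simp
end

section
/- Suppose G is connected. Let {i,j} ∈ E and let t be an integer with 0 < t < 6n². Then the expected number of traversals of the arc (i,j) before time t by the Metropolis–Hastings walk RW(G_1) started at i satisfies E_i N_{(i,j)}(t) < (5√t + 2Δ)·min(1/deg(i), 1/deg(j)). -/
open Finset

namespace MHAux

variable {V : Type*} [Fintype V] [DecidableEq V] (G : SimpleGraph V) [DecidableRel G.Adj]

lemma symm (u v : V) : mhMatrix G u v = mhMatrix G v u := by
  unfold mhMatrix
  simp only [Matrix.of_apply]
  by_cases h : u = v
  · subst h; rfl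
  · rw [if_neg (Ne.symm h), if_neg h, min_comm]
    simp only [G.adj_comm u v]

lemma adj_eq {u v : V} (h : G.Adj u v) :
    mhMatrix G u v = min ((G.degree u : ℝ))⁻¹ ((G.degree v : ℝ))⁻¹ := by
  unfold mhMatrix
  simp only [Matrix.of_apply]
  rw [if_neg h.ne', if_pos h]

lemma nonneg (u v : V) : 0 ≤ mhMatrix G u v := by
  unfold mhMatrix
  simp only [Matrix.of_apply]
  split_ifs
  · have h1 : ∑ w ∈ G.neighborFinset u, min ((G.degree u : ℝ))⁻¹ ((G.degree w : ℝ))⁻¹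
        ≤ ∑ w ∈ G.neighborFinset u, ((G.degree u : ℝ))⁻¹ :=
      Finset.sum_le_sum fun w _ => min_le_left _ _
    rw [Finset.sum_const, G.card_neighborFinset_eq_degree, nsmul_eq_mul] at h1
    have h2 := mul_inv_le_one (a := (G.degree u : ℝ))
    linarith
  · positivity
  · exact le_rfl

lemma row_sum (u : V) : ∑ v, mhMatrix G u v = 1 := by
  rw [← Finset.add_sum_erase _ _ (Finset.mem_univ u)]
  have h : ∑ v ∈ Finset.univ.erase u, mhMatrix G u v
      = ∑ w ∈ G.neighborFinset u, min ((G.degree u : ℝ))⁻¹ ((G.degree w : ℝ))⁻¹ := by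
    symm
    rw [Finset.sum_congr rfl (fun w hw => (adj_eq G ((G.mem_neighborFinset u w).1 hw)).symm)]
    apply Finset.sum_subset
    · intro w hw
      have := (G.mem_neighborFinset u w).1 hw
      simp [this.ne']
    · intro w hw hw'
      rw [G.mem_neighborFinset] at hw'
      have : w ≠ u := by simpa using hw
      simp [mhMatrix, this, hw']
  rw [h]
  simp [mhMatrix]

lemma pow_nonneg' (τ : ℕ) (u v : V) : 0 ≤ (mhMatrix G ^ τ) u v := by
  induction τ generalizing v with
  | zero => rw [pow_zero, Matrix.one_apply]; split_ifs <;> norm_num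
  | succ k ih =>
    rw [pow_succ, Matrix.mul_apply]
    exact Finset.sum_nonneg fun w _ => mul_nonneg (ih w) (nonneg G w v)

lemma pow_row_sum (τ : ℕ) (u : V) : ∑ v, (mhMatrix G ^ τ) u v = 1 := by
  induction τ with
  | zero => simp [Matrix.one_apply]
  | succ k ih =>
    simp only [pow_succ, Matrix.mul_apply]
    rw [Finset.sum_comm]
    simp only [← Finset.mul_sum, row_sum, mul_one, ih]

/-- Expected number of visits to `v` before time `t`. -/
noncomputable def gr (i : V) (t : ℕ) (v : V) : ℝ := ∑ τ ∈ Finset.range t, (mhMatrix G ^ τ) i v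

lemma gr_nonneg (i : V) (t : ℕ) (v : V) : 0 ≤ gr G i t v :=
  Finset.sum_nonneg fun τ _ => pow_nonneg' G τ i v

lemma gr_sum (i : V) (t : ℕ) : ∑ v, gr G i t v = t := by
  unfold gr
  rw [Finset.sum_comm]
  simp [pow_row_sum]

lemma gr_step (i : V) (t : ℕ) (v : V) :
    ∑ u, gr G i t u * mhMatrix G u v
      = gr G i t v + (mhMatrix G ^ t) i v - (if i = v then 1 else 0) := by
  induction t with
  | zero => simp [gr, Matrix.one_apply]
  | succ k ih =>
    have h : ∀ u, gr G i (k+1) u = gr G i k u + (mhMatrix G ^ k) i u := fun u => by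
      unfold gr; rw [Finset.sum_range_succ]
    simp only [h, add_mul, Finset.sum_add_distrib, ih, pow_succ, Matrix.mul_apply]
    ring

lemma energy (i : V) (t : ℕ) :
    ∑ u, ∑ v, mhMatrix G u v * (gr G i t u - gr G i t v) ^ 2 ≤ 2 * gr G i t i := by
  set g := gr G i t with hg
  have e1 : ∑ u, ∑ v, mhMatrix G u v * g u ^ 2 = ∑ u, g u ^ 2 := by
    simp only [← Finset.sum_mul, row_sum, one_mul]
  have e2 : ∑ u, ∑ v, mhMatrix G u v * g v ^ 2 = ∑ u, g u ^ 2 := by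
    rw [Finset.sum_comm]
    simp only [← Finset.sum_mul]
    refine Finset.sum_congr rfl fun v _ => ?_
    have : ∑ u, mhMatrix G u v = 1 := by
      rw [← row_sum G v]; exact Finset.sum_congr rfl fun u _ => symm G u v
    rw [this, one_mul]
  have e3 : ∑ u, ∑ v, mhMatrix G u v * (g u * g v)
      = ∑ v, g v ^ 2 + ∑ v, (mhMatrix G ^ t) i v * g v - g i := by
    rw [Finset.sum_comm]
    have : ∀ v, ∑ u, mhMatrix G u v * (g u * g v)
        = g v ^ 2 + (mhMatrix G ^ t) i v * g v - (if i = v then g v else 0) := fun v => by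
      have h := gr_step G i t v
      calc ∑ u, mhMatrix G u v * (g u * g v) = (∑ u, g u * mhMatrix G u v) * g v := by
            rw [Finset.sum_mul]; exact Finset.sum_congr rfl fun u _ => by ring
        _ = _ := by
            rw [hg, h]; split_ifs <;> ring
    simp only [this, Finset.sum_sub_distrib, Finset.sum_add_distrib]
    simp
  have e4 : 0 ≤ ∑ v, (mhMatrix G ^ t) i v * g v :=
    Finset.sum_nonneg fun v _ => mul_nonneg (pow_nonneg' G t i v) (gr_nonneg G i t v)
  have e5 : ∑ u, ∑ v, mhMatrix G u v * (g u - g v) ^ 2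
      = ∑ u, ∑ v, mhMatrix G u v * g u ^ 2 + ∑ u, ∑ v, mhMatrix G u v * g v ^ 2
        - 2 * ∑ u, ∑ v, mhMatrix G u v * (g u * g v) := by
    simp only [Finset.mul_sum, ← Finset.sum_add_distrib, ← Finset.sum_sub_distrib]
    exact Finset.sum_congr rfl fun u _ => Finset.sum_congr rfl fun v _ => by ring
  rw [e5, e1, e2, e3]
  linarith

/-- Geodesics. -/
lemma geodesic (hG : G.Connected) (i v : V) :
    ∃ p : ℕ → V, p 0 = i ∧ p (G.dist i v) = v ∧ (∀ l ≤ G.dist i v, G.dist i (p l) = l) ∧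
      ∀ l < G.dist i v, G.Adj (p l) (p (l+1)) := by
  obtain ⟨w, hw⟩ := hG.exists_walk_length_eq_dist i v
  refine ⟨w.getVert, by simp, by rw [← hw]; simp, ?_, ?_⟩
  · intro l hl
    have h1 : G.dist i (w.getVert l) ≤ l := by
      refine (SimpleGraph.dist_le (w.take l)).trans ?_
      rw [SimpleGraph.Walk.take_length]; exact min_le_left _ _
    have h2 : G.dist (w.getVert l) v ≤ G.dist i v - l := by
      refine (SimpleGraph.dist_le (w.drop l)).trans ?_
      rw [SimpleGraph.Walk.drop_length, hw]
    have h3 := hG.dist_triangle (u := i) (v := w.getVert l) (w := v)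
    omega
  · intro l hl
    exact w.adj_getVert_succ (by omega)

/-- Potential drop along a geodesic. -/
lemma path_drop (hG : G.Connected) (i : V) (t : ℕ) (c : ℝ) (hc : 0 < c) (k : ℕ) (p : ℕ → V)
    (p0 : p 0 = i) (pd : ∀ l ≤ k, G.dist i (p l) = l) (pa : ∀ l < k, G.Adj (p l) (p (l+1))) :
    gr G i t i - gr G i t (p k) ≤
      (∑ l ∈ Finset.range k, max (G.degree (p l) : ℝ) (G.degree (p (l+1)))) / (2 * c)
        + c / 2 * gr G i t i := by
  set g := gr G i t with hg
  have tele : g i - g (p k) = ∑ l ∈ Finset.range k, (g (p l) - g (p (l+1))) := by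
    rw [Finset.sum_range_sub' (fun l => g (p l)), p0]
  let f : V × V → ℝ := fun x => mhMatrix G x.1 x.2 * (g x.1 - g x.2) ^ 2
  have f0 : ∀ x, 0 ≤ f x := fun x => mul_nonneg (nonneg G _ _) (sq_nonneg _)
  have en : ∑ x, f x ≤ 2 * g i := by
    rw [Fintype.sum_prod_type]; exact energy G i t
  have inj : Set.InjOn (fun l => (p l, p (l+1))) (Finset.range k : Set ℕ) := by
    intro a ha b hb hab
    simp only [Finset.coe_range, Set.mem_Iio] at ha hb
    have h1 : p a = p b := (Prod.ext_iff.1 hab).1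
    rw [← pd a ha.le, ← pd b hb.le, h1]
  have inj' : Set.InjOn (fun l => (p (l+1), p l)) (Finset.range k : Set ℕ) := by
    intro a ha b hb hab
    simp only [Finset.coe_range, Set.mem_Iio] at ha hb
    have h1 : p a = p b := (Prod.ext_iff.1 hab).2
    rw [← pd a ha.le, ← pd b hb.le, h1]
  have disj : Disjoint ((Finset.range k).image (fun l => (p l, p (l+1))))
      ((Finset.range k).image (fun l => (p (l+1), p l))) := by
    rw [Finset.disjoint_left]
    intro x hx hy
    simp only [Finset.mem_image, Finset.mem_range] at hx hy
    obtain ⟨a, ha, rfl⟩ := hx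
    obtain ⟨b, hb, hab⟩ := hy
    have h1 : p (b+1) = p a := (Prod.ext_iff.1 hab).1
    have h2 : p b = p (a+1) := (Prod.ext_iff.1 hab).2
    have h3 := pd a ha.le
    have h4 := pd b hb.le
    rw [← h1, pd (b+1) hb] at h3
    rw [h2, pd (a+1) ha] at h4
    omega
  have sums : 2 * ∑ l ∈ Finset.range k, f (p l, p (l+1)) ≤ ∑ x, f x := by
    have h1 : ∑ x ∈ (Finset.range k).image (fun l => (p l, p (l+1))) ∪
      ((Finset.range k).image (fun l => (p (l+1), p l))), f x ≤ ∑ x, f x :=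
      Finset.sum_le_sum_of_subset_of_nonneg (Finset.subset_univ _) fun x _ _ => f0 x
    rw [Finset.sum_union disj, Finset.sum_image inj, Finset.sum_image inj'] at h1
    have h2 : ∑ l ∈ Finset.range k, f (p (l+1), p l) = ∑ l ∈ Finset.range k, f (p l, p (l+1)) := by
      refine Finset.sum_congr rfl fun l _ => ?_
      simp only [f]
      rw [symm G (p (l+1)) (p l)]; ring
    linarith
  have step : ∀ l ∈ Finset.range k, g (p l) - g (p (l+1)) ≤
      max (G.degree (p l) : ℝ) (G.degree (p (l+1))) / (2 * c) + c / 2 * f (p l, p (l+1)) := by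
    intro l hl
    have ha := pa l (Finset.mem_range.1 hl)
    have d1 : (0:ℝ) < G.degree (p l) := by
      exact_mod_cast (G.degree_pos_iff_exists_adj _).2 ⟨_, ha⟩
    have d2 : (0:ℝ) < G.degree (p (l+1)) := by
      exact_mod_cast (G.degree_pos_iff_exists_adj _).2 ⟨_, ha.symm⟩
    have hP : mhMatrix G (p l) (p (l+1))
        = (max (G.degree (p l) : ℝ) (G.degree (p (l+1))))⁻¹ := by
      rw [adj_eq G ha]
      rcases le_total (G.degree (p l) : ℝ) (G.degree (p (l+1))) with h | h
      · rw [max_eq_right h, min_eq_right]; exact inv_anti₀ d1 h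
      · rw [max_eq_left h, min_eq_left]; exact inv_anti₀ d2 h
    simp only [f, hP]
    have hr : 0 < max (G.degree (p l) : ℝ) (G.degree (p (l+1))) := lt_max_of_lt_left d1
    generalize max (G.degree (p l) : ℝ) (G.degree (p (l+1))) = r at hr
    generalize g (p l) - g (p (l+1)) = x
    have : r / (2 * c) + c / 2 * (r⁻¹ * x ^ 2) - x = (r - c * x) ^ 2 / (2 * c * r) := by
      field_simp; ring
    have h2 : 0 ≤ (r - c * x) ^ 2 / (2 * c * r) := by positivity
    linarith
  rw [tele]
  refine (Finset.sum_le_sum step).trans ?_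
  rw [Finset.sum_add_distrib, ← Finset.sum_div, ← Finset.mul_sum]
  have : ∑ l ∈ Finset.range k, f (p l, p (l+1)) ≤ g i := by linarith
  have := mul_le_mul_of_nonneg_left this (by positivity : 0 ≤ c / 2)
  linarith

/-- Resistance of a geodesic, up to its last two edges. -/
lemma path_res (hG : G.Connected) (i : V) (k : ℕ) (p : ℕ → V)
    (pd : ∀ l ≤ k, G.dist i (p l) = l) (m : ℕ) (hm : m + 2 ≤ k) :
    ∑ l ∈ Finset.range m, max (G.degree (p l)) (G.degree (p (l+1)))
      ≤ 4 * (Finset.univ.filter fun w => G.dist i w < k).card := by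
  have hc : ∀ l, ∃ q, (q = p l ∨ q = p (l+1)) ∧
      max (G.degree (p l)) (G.degree (p (l+1))) = G.degree q := by
    intro l
    rcases le_total (G.degree (p l)) (G.degree (p (l+1))) with h | h
    · exact ⟨_, Or.inr rfl, max_eq_right h⟩
    · exact ⟨_, Or.inl rfl, max_eq_left h⟩
  choose q hq hq' using hc
  have near : ∀ l < m, ∀ w, G.Adj (q l) w → G.dist i w ≤ l + 2 ∧ l ≤ G.dist i w + 1 := by
    intro l hl w hw
    have h1 := hG.dist_triangle (u := i) (v := q l) (w := w)
    have h2 := hG.dist_triangle (u := i) (v := w) (w := q l)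
    rw [SimpleGraph.dist_eq_one_iff_adj.2 hw] at h1
    rw [SimpleGraph.dist_eq_one_iff_adj.2 hw.symm] at h2
    have h3 : G.dist i (q l) = l ∨ G.dist i (q l) = l + 1 := by
      rcases hq l with h | h
      · left; rw [h]; exact pd _ (by omega)
      · right; rw [h]; exact pd _ (by omega)
    omega
  calc ∑ l ∈ Finset.range m, max (G.degree (p l)) (G.degree (p (l+1)))
      = ∑ l ∈ Finset.range m, ((Finset.univ.filter fun w => G.dist i w < k).filter
          fun w => G.Adj (q l) w).card := by
        refine Finset.sum_congr rfl fun l hl => ?_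
        rw [hq', ← G.card_neighborFinset_eq_degree]
        congr 1
        ext w
        simp only [SimpleGraph.mem_neighborFinset, Finset.mem_filter, Finset.mem_univ, true_and]
        refine ⟨fun h => ⟨?_, h⟩, fun h => h.2⟩
        have hl := Finset.mem_range.1 hl
        have := near l hl w h
        omega
    _ = ∑ w ∈ Finset.univ.filter (fun w => G.dist i w < k),
          ((Finset.range m).filter fun l => G.Adj (q l) w).card :=
        Finset.sum_card_bipartiteAbove_eq_sum_card_bipartiteBelow (fun l w => G.Adj (q l) w)
    _ ≤ ∑ w ∈ Finset.univ.filter (fun w => G.dist i w < k), 4 := by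
        refine Finset.sum_le_sum fun w _ => ?_
        have : (Finset.range m).filter (fun l => G.Adj (q l) w)
            ⊆ Finset.Icc (G.dist i w - 2) (G.dist i w + 1) := by
          intro l hl
          simp only [Finset.mem_filter, Finset.mem_range] at hl
          have := near l hl.1 w hl.2
          rw [Finset.mem_Icc]; omega
        refine (Finset.card_le_card this).trans ?_
        rw [Nat.card_Icc]; omega
    _ = _ := by rw [Finset.sum_const, smul_eq_mul, mul_comm]

lemma path_res' (hG : G.Connected) (i : V) (k : ℕ) (p : ℕ → V)
    (pd : ∀ l ≤ k, G.dist i (p l) = l) :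
    ∑ l ∈ Finset.range k, max (G.degree (p l)) (G.degree (p (l+1)))
      ≤ 4 * (Finset.univ.filter fun w => G.dist i w < k).card + 2 * G.maxDegree := by
  have hm : ∀ l, max (G.degree (p l)) (G.degree (p (l+1))) ≤ G.maxDegree := fun l =>
    max_le (G.degree_le_maxDegree _) (G.degree_le_maxDegree _)
  rcases k with _ | _ | m
  · simp
  · have := hm 0
    simp only [zero_add, Finset.sum_range_one] at *
    omega
  · rw [Finset.sum_range_succ, Finset.sum_range_succ]
    have h1 := path_res G hG i (m+1+1) p pd m le_rfl
    have h2 := hm m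
    have h3 := hm (m+1)
    omega

lemma drop (hG : G.Connected) (i : V) (t : ℕ) (c : ℝ) (hc : 0 < c) (v : V) :
    gr G i t i - gr G i t v ≤
      (4 * ((Finset.univ.filter fun w => G.dist i w < G.dist i v).card : ℝ)
        + 2 * G.maxDegree) / (2 * c) + c / 2 * gr G i t i := by
  obtain ⟨p, p0, pk, pd, pa⟩ := geodesic G hG i v
  have h1 := path_drop G hG i t c hc _ p p0 pd pa
  rw [pk] at h1
  refine h1.trans ?_
  have h2 := path_res' G hG i _ p pd
  have h3 : ∑ l ∈ Finset.range (G.dist i v), max (G.degree (p l) : ℝ) (G.degree (p (l+1))) ≤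
      4 * ((Finset.univ.filter fun w => G.dist i w < G.dist i v).card : ℝ)
        + 2 * G.maxDegree := by exact_mod_cast h2
  gcongr

/-- Enumeration of the vertices by distance. -/
lemma enum (i : V) : ∃ e : Fin (Fintype.card V) ≃ V, ∀ m,
    (Finset.univ.filter fun w => G.dist i w < G.dist i (e m)).card ≤ (m : ℕ) := by
  let e0 := (Fintype.equivFin V).symm
  let σ := Tuple.sort (fun m => G.dist i (e0 m))
  have hσ : Monotone ((fun m => G.dist i (e0 m)) ∘ σ) := Tuple.monotone_sort _
  refine ⟨σ.trans e0, fun m => ?_⟩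
  have : (Finset.univ.filter fun w => G.dist i w < G.dist i ((σ.trans e0) m))
      ⊆ (Finset.Iio m).image (σ.trans e0) := by
    intro w hw
    simp only [Finset.mem_filter, Finset.mem_univ, true_and] at hw
    refine Finset.mem_image.2 ⟨(σ.trans e0).symm w, ?_, by simp⟩
    rw [Finset.mem_Iio]
    by_contra hcon
    have h := hσ (not_lt.1 hcon)
    have h' : G.dist i ((σ.trans e0) m) ≤
      G.dist i ((σ.trans e0) ((σ.trans e0).symm w)) := h
    rw [Equiv.apply_symm_apply] at h'
    omega
  refine (Finset.card_le_card this).trans (Finset.card_image_le.trans ?_)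
  simp

lemma sum_bound (hG : G.Connected) (i : V) (t : ℕ) (c : ℝ) (hc : 0 < c) (M : ℕ)
    (hM : M ≤ Fintype.card V) :
    M * (gr G i t i * (1 - c / 2) - G.maxDegree / c) - M * (M - 1) / c ≤ t := by
  obtain ⟨e, he⟩ := enum G i
  have h1 : ∑ m ∈ Finset.range M, (gr G i t i * (1 - c / 2) - G.maxDegree / c - 2 * m / c)
      = M * (gr G i t i * (1 - c / 2) - G.maxDegree / c) - M * (M - 1) / c := by
    clear hM
    induction M with
    | zero => simp
    | succ k ih => rw [Finset.sum_range_succ, ih]; push_cast; field_simp; ring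
  let h : ℕ → ℝ := fun m => if hm : m < Fintype.card V then gr G i t (e ⟨m, hm⟩) else 0
  have h0 : ∀ m, 0 ≤ h m := fun m => by
    simp only [h]; split_ifs
    · exact gr_nonneg G i t _
    · exact le_rfl
  have h2 : (t : ℝ) = ∑ m ∈ Finset.range (Fintype.card V), h m := by
    rw [← gr_sum G i t, ← e.sum_comp, Finset.sum_range]
    exact Finset.sum_congr rfl fun m _ => by simp [h]
  rw [← h1, h2]
  refine le_trans (Finset.sum_le_sum fun m hm => ?_)
    (Finset.sum_le_sum_of_subset_of_nonneg (Finset.range_mono hM) fun m _ _ => h0 m)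
  have hm' : m < Fintype.card V := (Finset.mem_range.1 hm).trans_le hM
  simp only [h, dif_pos hm']
  have hd := drop G hG i t c hc (e ⟨m, hm'⟩)
  have hr : ((Finset.univ.filter fun w => G.dist i w < G.dist i (e ⟨m, hm'⟩)).card : ℝ) ≤ m := by
    exact_mod_cast he ⟨m, hm'⟩
  have h3 : (4 * ((Finset.univ.filter fun w => G.dist i w < G.dist i (e ⟨m, hm'⟩)).card : ℝ)
        + 2 * G.maxDegree) / (2 * c) ≤ (4 * m + 2 * G.maxDegree) / (2 * c) := by gcongr
  have h4 : (4 * (m : ℝ) + 2 * G.maxDegree) / (2 * c) = 2 * m / c + G.maxDegree / c := by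
    field_simp; ring
  linarith

lemma main_bound (hG : G.Connected) (i : V) (t : ℕ)
    (ht0 : 0 < t) (ht : t < 6 * Fintype.card V ^ 2) :
    gr G i t i < 5 * Real.sqrt t + 2 * (G.maxDegree : ℝ) := by
  set S := gr G i t i with hS
  have tpos : (0:ℝ) < t := by exact_mod_cast ht0
  set s := Real.sqrt t with hs
  have spos : 0 < s := Real.sqrt_pos.2 tpos
  have ss : s * s = t := Real.mul_self_sqrt tpos.le
  have ht' : (t:ℝ) < 6 * (Fintype.card V : ℝ) ^ 2 := by exact_mod_cast ht
  have bound := sum_bound G hG i t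
  have hne : Nonempty V := ⟨i⟩
  have hΔ : (G.maxDegree : ℝ) ≤ Fintype.card V := by
    exact_mod_cast (G.maxDegree_lt_card_verts).le
  have npos : (0:ℝ) < Fintype.card V := by exact_mod_cast Fintype.card_pos
  set n := Fintype.card V with hn
  by_contra hcon
  rw [not_lt] at hcon
  set D : ℝ := (G.maxDegree : ℝ) with hD
  have D0 : 0 ≤ D := by positivity
  have U0 : 0 ≤ (S - 2 * D) / 4 := by linarith
  by_cases hU : ⌈(S - 2 * D) / 4⌉₊ ≤ n
  · have b := bound 1 one_pos _ hU
    have c1 := Nat.le_ceil ((S - 2 * D) / 4)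
    have c2 := Nat.ceil_lt_add_one U0
    set M : ℝ := (⌈(S - 2 * D) / 4⌉₊ : ℝ) with hM
    rw [← hS] at b
    have : ((S - 2 * D) / 4) * ((S - 2 * D) / 4) ≤ t := by
      nlinarith [mul_nonneg (sub_nonneg.2 c1) (sub_nonneg.2 c2.le)]
    have : 5 * s / 4 ≤ (S - 2 * D) / 4 := by linarith
    nlinarith
  · have hU' : (n:ℝ) < (S - 2 * D) / 4 := Nat.lt_ceil.1 (not_le.1 hU)
    have b1 := bound 1 one_pos n le_rfl
    have b2 := bound (1/2) (by norm_num) n le_rfl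
    rw [← hS] at b1 b2
    generalize (n : ℝ) = N at *
    have hsN : N < s := by
      have : N * N < s * s := by nlinarith
      nlinarith
    have hsN2 : s < 2.45 * N := by
      by_contra hh
      rw [not_lt] at hh
      nlinarith
    have k1 : N * (5 * s + 2 * D) ≤ N * S := by gcongr
    have k2 : N * D ≤ N * N := by gcongr
    nlinarith [mul_nonneg (sub_nonneg.2 hsN.le) (sub_nonneg.2 hsN2.le)]

end MHAux

/-- For a connected graph `G`, an edge `{i,j} ∈ E` and `0 < t < 6n²`, the expected number
of traversals of the arc `(i,j)` before time `t` by the Metropolis–Hastings walk started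
at `i`, namely `∑_{τ<t} (P^τ)_{ii} · P i j`, is less than
`(5√t + 2Δ) · min (1/deg i) (1/deg j)`. -/
theorem mh_arc_visits_from_endpoint {V : Type*} [Fintype V] [DecidableEq V]
    (G : SimpleGraph V) [DecidableRel G.Adj] (hG : G.Connected)
    (i j : V) (hij : G.Adj i j) (t : ℕ)
    (ht0 : 0 < t) (ht : t < 6 * Fintype.card V ^ 2) :
    ∑ τ ∈ Finset.range t, (mhMatrix G ^ τ) i i * mhMatrix G i j <
      (5 * Real.sqrt t + 2 * (G.maxDegree : ℝ)) *
        min ((G.degree i : ℝ))⁻¹ ((G.degree j : ℝ))⁻¹ := by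
  rw [← Finset.sum_mul, MHAux.adj_eq G hij]
  have d1 : (0:ℝ) < G.degree i := by
    exact_mod_cast (G.degree_pos_iff_exists_adj _).2 ⟨_, hij⟩
  have d2 : (0:ℝ) < G.degree j := by
    exact_mod_cast (G.degree_pos_iff_exists_adj _).2 ⟨_, hij.symm⟩
  exact mul_lt_mul_of_pos_right (MHAux.main_bound G hG i t ht0 ht)
    (lt_min (inv_pos.2 d1) (inv_pos.2 d2))
end
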